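/- arXiv:2404.02030 — 2 statements merged into one kernel-verified Lean document; each statement's English description precedes it below -/
import Mathlib

section
/- There are constants K₁, ε*>0 such that the following holds. For all 0<ε₁<(ε*)^{K₁²} there is ε₂*:ℕ→(0,1) such that for all t≥1 and all ε₂:ℕ→(0,1) with ε₂(x)<ε₂*(x) for all x, there is ε>0 such that for all sufficiently large n the following holds, where K := ε₁^{-1/K₁²}. Let 𝒢=U_bg(K) and suppose Γ=(A∪B,(P_S)_{S⊆[K]}) is a bipartite 𝒫([K])-colored graph with |A|=|B|=n such that for each S⊆[K], (A∪B,P_S) is ε-regular with density 2^{-K} ± ε. Suppose H is an (n/K,Γ)-blowup of 𝒢 and 𝒫 is a dev_{2,3}(ε₁^{K₁},ε₂(ℓ)^{K₁})-regular (t,ℓ,ε₁^{K₁},ε₂(ℓ)^{K₁})-decomposition of H. Then ℓ ≥ 2^{K/2}. -/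
open scoped Classical
open Finset

set_option maxHeartbeats 1000000

/-- A 3-uniform hypergraph on a finite vertex set of naturals. -/
structure ThreeGraph where
  verts : Finset ℕ
  edges : Finset (Finset ℕ)
  edges_sub : ∀ e ∈ edges, e ⊆ verts ∧ e.card = 3

/-- The set `Ē` of ordered triples corresponding to edges. -/
def ThreeGraph.obar (H : ThreeGraph) : Finset (ℕ × ℕ × ℕ) :=
  (H.verts ×ˢ H.verts ×ˢ H.verts).filter fun p => ({p.1, p.2.1, p.2.2} : Finset ℕ) ∈ H.edges

/-- A bigraph `(U,V;E)`. -/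
structure Bigraph where
  left : Finset ℕ
  right : Finset ℕ
  edges : Finset (ℕ × ℕ)
  edges_sub : edges ⊆ left ×ˢ right

noncomputable def Bigraph.density (B : Bigraph) : ℝ :=
  (B.edges.card : ℝ) / ((B.left.card : ℝ) * (B.right.card : ℝ))

noncomputable def Bigraph.gfun (B : Bigraph) (u w : ℕ) : ℝ :=
  if (u, w) ∈ B.edges then 1 - B.density else -B.density

noncomputable def Bigraph.devSum (B : Bigraph) : ℝ :=
  ∑ u₀ ∈ B.left, ∑ u₁ ∈ B.left, ∑ w₀ ∈ B.right, ∑ w₁ ∈ B.right,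
    B.gfun u₀ w₀ * B.gfun u₀ w₁ * B.gfun u₁ w₀ * B.gfun u₁ w₁

/-- `B` has `dev₂(ε,d)`. -/
def Bigraph.dev2 (B : Bigraph) (ε d : ℝ) : Prop :=
  |B.density - d| ≤ ε ∧ B.devSum ≤ ε * (B.left.card : ℝ) ^ 2 * (B.right.card : ℝ) ^ 2

/-- `B` has `dev₂(ε)`, i.e. `dev₂(ε, d_B)`. -/
def Bigraph.dev2self (B : Bigraph) (ε : ℝ) : Prop := B.dev2 ε B.density

noncomputable def Bigraph.dBetween (B : Bigraph) (X Y : Finset ℕ) : ℝ :=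
  ((B.edges ∩ X ×ˢ Y).card : ℝ) / ((X.card : ℝ) * (Y.card : ℝ))

/-- `ε`-regularity for a bigraph. -/
def Bigraph.EpsRegular (B : Bigraph) (ε : ℝ) : Prop :=
  ∀ X ⊆ B.left, ∀ Y ⊆ B.right,
    ε * (B.left.card : ℝ) ≤ (X.card : ℝ) → ε * (B.right.card : ℝ) ≤ (Y.card : ℝ) →
      |B.density - B.dBetween X Y| ≤ ε

/-- Irreducibility: distinct vertices have distinct neighborhoods, on both sides. -/
def Bigraph.Irreducible (B : Bigraph) : Prop :=
  (∀ u ∈ B.left, ∀ u' ∈ B.left, (∀ v : ℕ, (u, v) ∈ B.edges ↔ (u', v) ∈ B.edges) → u = u') ∧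
  (∀ v ∈ B.right, ∀ v' ∈ B.right, (∀ u : ℕ, (u, v) ∈ B.edges ↔ (u, v') ∈ B.edges) → v = v')

def Bigraph.leftNbhd (B : Bigraph) (v : ℕ) : Finset ℕ :=
  B.left.filter fun u => (u, v) ∈ B.edges

/-- `B` contains an induced copy of the abstract bigraph on `Fin k × Fin k` given by `F`. -/
def Bigraph.HasInducedPattern (B : Bigraph) (k : ℕ) (F : Fin k → Fin k → Prop) : Prop :=
  ∃ u v : Fin k → ℕ, (∀ a, u a ∈ B.left) ∧ (∀ b, v b ∈ B.right) ∧
    ∀ a b, ((u a, v b) ∈ B.edges ↔ F a b)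

/-- A triad `(X,Y,Z; E_XY, E_YZ, E_XZ)`. -/
structure Triad where
  X : Finset ℕ
  Y : Finset ℕ
  Z : Finset ℕ
  EXY : Finset (ℕ × ℕ)
  EYZ : Finset (ℕ × ℕ)
  EXZ : Finset (ℕ × ℕ)
  hXY : EXY ⊆ X ×ˢ Y
  hYZ : EYZ ⊆ Y ×ˢ Z
  hXZ : EXZ ⊆ X ×ˢ Z

def Triad.K3 (G : Triad) : Finset (ℕ × ℕ × ℕ) :=
  (G.X ×ˢ G.Y ×ˢ G.Z).filter fun p =>
    (p.1, p.2.1) ∈ G.EXY ∧ (p.2.1, p.2.2) ∈ G.EYZ ∧ (p.1, p.2.2) ∈ G.EXZ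

def Triad.bXY (G : Triad) : Bigraph := ⟨G.X, G.Y, G.EXY, G.hXY⟩
def Triad.bYZ (G : Triad) : Bigraph := ⟨G.Y, G.Z, G.EYZ, G.hYZ⟩
def Triad.bXZ (G : Triad) : Bigraph := ⟨G.X, G.Z, G.EXZ, G.hXZ⟩

/-- `d_H(G)` where the (tri)graph is given by its set `R` of ordered triples. -/
noncomputable def relDensity (R : Finset (ℕ × ℕ × ℕ)) (G : Triad) : ℝ :=
  ((R ∩ G.K3).card : ℝ) / (G.K3.card : ℝ)

noncomputable def hFun (R : Finset (ℕ × ℕ × ℕ)) (G : Triad) (x y z : ℕ) : ℝ :=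
  if (x, y, z) ∈ G.K3 then
    (if (x, y, z) ∈ R then 1 - relDensity R G else -(relDensity R G))
  else 0

noncomputable def devSum3 (R : Finset (ℕ × ℕ × ℕ)) (G : Triad) : ℝ :=
  ∑ u₀ ∈ G.X, ∑ u₁ ∈ G.X, ∑ w₀ ∈ G.Y, ∑ w₁ ∈ G.Y, ∑ z₀ ∈ G.Z, ∑ z₁ ∈ G.Z,
    hFun R G u₀ w₀ z₀ * hFun R G u₀ w₀ z₁ * hFun R G u₀ w₁ z₀ * hFun R G u₀ w₁ z₁ *
      hFun R G u₁ w₀ z₀ * hFun R G u₁ w₀ z₁ * hFun R G u₁ w₁ z₀ * hFun R G u₁ w₁ z₁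

/-- `(H,G)` has `dev_{2,3}(ε₁,ε₂)`, where the trigraph/3-graph is given by triples `R`. -/
def dev23 (R : Finset (ℕ × ℕ × ℕ)) (G : Triad) (ε₁ ε₂ : ℝ) : Prop :=
  ∃ dXY dYZ dXZ : ℝ, 0 < dXY ∧ 0 < dYZ ∧ 0 < dXZ ∧
    G.bXY.dev2 ε₂ dXY ∧ G.bXZ.dev2 ε₂ dXZ ∧ G.bYZ.dev2 ε₂ dYZ ∧
    devSum3 R G ≤ ε₁ * dXY ^ 4 * dYZ ^ 4 * dXZ ^ 4 *
      (G.X.card : ℝ) ^ 2 * (G.Y.card : ℝ) ^ 2 * (G.Z.card : ℝ) ^ 2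

/-- `G` is `μ`-homogeneous with respect to the triples `R`: `d_H(G) ∈ [0,μ) ∪ (1-μ,1]`. -/
def homTriad (R : Finset (ℕ × ℕ × ℕ)) (G : Triad) (μ : ℝ) : Prop :=
  relDensity R G < μ ∨ 1 - μ < relDensity R G

/-- A `(t,ℓ)`-decomposition of `V`, with part-indices `ι` and pair-indices `κ`. -/
structure Decomp (V : Finset ℕ) (ι κ : Type) where
  part : ι → Finset ℕ
  part_sub : ∀ i, part i ⊆ V
  part_disj : ∀ i j, i ≠ j → Disjoint (part i) (part j)
  part_cover : ∀ x ∈ V, ∃ i, x ∈ part i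
  pairs : ι → ι → κ → Finset (ℕ × ℕ)
  pairs_sub : ∀ i j α, pairs i j α ⊆ part i ×ˢ part j
  pairs_disj : ∀ i j α β, α ≠ β → Disjoint (pairs i j α) (pairs i j β)
  pairs_cover : ∀ i j, ∀ p ∈ part i ×ˢ part j, ∃ α, p ∈ pairs i j α

def Decomp.pairBG {V : Finset ℕ} {ι κ : Type} (P : Decomp V ι κ) (i j : ι) (α : κ) : Bigraph :=
  ⟨P.part i, P.part j, P.pairs i j α, P.pairs_sub i j α⟩

/-- The triad `G^{ijk}_{α,β,γ} = (V_i,V_j,V_k; P^α_{ij}, P^β_{ik}, P^γ_{jk})`. -/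
def Decomp.triadOf {V : Finset ℕ} {ι κ : Type} (P : Decomp V ι κ) (i j k : ι) (α β γ : κ) :
    Triad :=
  ⟨P.part i, P.part j, P.part k, P.pairs i j α, P.pairs j k γ, P.pairs i k β,
    P.pairs_sub i j α, P.pairs_sub j k γ, P.pairs_sub i k β⟩

/-- `P` is a `(t,ℓ,ε₁,ε₂)`-decomposition. -/
def Decomp.isReg {V : Finset ℕ} {ι κ : Type} (P : Decomp V ι κ) (ε₁ ε₂ : ℝ) : Prop :=
  (1 - ε₁) * (V.card : ℝ) ^ 2 ≤
    (((V ×ˢ V).filter fun p =>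
      ∃ i j α, p ∈ P.pairs i j α ∧ (P.pairBG i j α).dev2self ε₂).card : ℝ)

/-- `P` is equitable. -/
def Decomp.isEquitable {V : Finset ℕ} {ι κ : Type} [Fintype κ]
    (P : Decomp V ι κ) (ε₁ ε₂ : ℝ) : Prop :=
  (∀ i j, (P.part i).card ≤ (P.part j).card + 1) ∧
  (1 - ε₁) * (V.card : ℝ) ^ 2 ≤
    (((V ×ˢ V).filter fun p =>
      ∃ i j α, p ∈ P.pairs i j α ∧
        (P.pairBG i j α).dev2 ε₂ (1 / (Fintype.card κ : ℝ))).card : ℝ)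

/-- `P` is `dev_{2,3}(ε₁,ε₂)`-regular with respect to the triples `R`. -/
def Decomp.regWrt {V : Finset ℕ} {ι κ : Type} (P : Decomp V ι κ)
    (R : Finset (ℕ × ℕ × ℕ)) (ε₁ ε₂ : ℝ) : Prop :=
  (1 - ε₁) * (V.card : ℝ) ^ 3 ≤
    (((V ×ˢ V ×ˢ V).filter fun p =>
      ∃ i j k α β γ, p ∈ (P.triadOf i j k α β γ).K3 ∧
        dev23 R (P.triadOf i j k α β γ) ε₁ ε₂).card : ℝ)

/-- The triad `G^{ijk}_{α,β,γ}` of `P` is `μ`-non-trivial. -/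
def Decomp.nonTrivTriad {V : Finset ℕ} {t ℓ : ℕ} (P : Decomp V (Fin t) (Fin ℓ)) (μ : ℝ)
    (i j k : Fin t) (α β γ : Fin ℓ) : Prop :=
  μ * (V.card : ℝ) / (t : ℝ) ≤ ((P.part i).card : ℝ) ∧
  μ * (V.card : ℝ) / (t : ℝ) ≤ ((P.part j).card : ℝ) ∧
  μ * (V.card : ℝ) / (t : ℝ) ≤ ((P.part k).card : ℝ) ∧
  μ * ((P.part i).card : ℝ) * ((P.part j).card : ℝ) / (ℓ : ℝ) ≤ ((P.pairs i j α).card : ℝ) ∧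
  μ * ((P.part i).card : ℝ) * ((P.part k).card : ℝ) / (ℓ : ℝ) ≤ ((P.pairs i k β).card : ℝ) ∧
  μ * ((P.part j).card : ℝ) * ((P.part k).card : ℝ) / (ℓ : ℝ) ≤ ((P.pairs j k γ).card : ℝ)

/-- `H` has a `dev_{2,3}(ε₁,ε₂)`-regular `(t,ℓ,ε₁,ε₂)`-decomposition. -/
def GoodDecomp (H : ThreeGraph) (t ℓ : ℕ) (ε₁ ε₂ : ℝ) : Prop :=
  ∃ P : Decomp H.verts (Fin t) (Fin ℓ), P.isReg ε₁ ε₂ ∧ P.regWrt H.obar ε₁ ε₂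

def ThreeGraph.Iso (H₁ H₂ : ThreeGraph) : Prop :=
  ∃ f : ℕ → ℕ, Set.BijOn f ↑H₁.verts ↑H₂.verts ∧
    ∀ x ∈ H₁.verts, ∀ y ∈ H₁.verts, ∀ z ∈ H₁.verts,
      (({x, y, z} : Finset ℕ) ∈ H₁.edges ↔ ({f x, f y, f z} : Finset ℕ) ∈ H₂.edges)

def ThreeGraph.induce (H : ThreeGraph) (W : Finset ℕ) : ThreeGraph where
  verts := H.verts ∩ W
  edges := H.edges.filter fun e => e ⊆ W
  edges_sub := by
    intro e he
    rw [Finset.mem_filter] at he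
    obtain ⟨hsub, hcard⟩ := H.edges_sub e he.1
    exact ⟨fun x hx => Finset.mem_inter.mpr ⟨hsub hx, he.2 hx⟩, hcard⟩

/-- A hereditary property of 3-graphs. -/
def Hereditary (ℋ : Set ThreeGraph) : Prop :=
  (∀ H₁ H₂ : ThreeGraph, ThreeGraph.Iso H₁ H₂ → H₁ ∈ ℋ → H₂ ∈ ℋ) ∧
  (∀ H ∈ ℋ, ∀ W : Finset ℕ, H.induce W ∈ ℋ)

/-- The statement `ψ(ε₁,ε₂,T,L,ℋ)`. -/
def psi (ε₁ : ℝ) (ε₂ : ℕ → ℝ) (T L : ℕ) (ℋ : Set ThreeGraph) : Prop :=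
  ∃ n₀ : ℕ, ∀ H ∈ ℋ, n₀ ≤ H.verts.card →
    ∃ t ℓ : ℕ, 1 ≤ t ∧ t ≤ T ∧ 1 ≤ ℓ ∧ ℓ ≤ L ∧ GoodDecomp H t ℓ ε₁ (ε₂ ℓ)

/-- `L_ℋ(ε₁,ε₂)`: minimal `L` such that `ψ(ε₁,ε₂,T,L,ℋ)` holds for some `T ≥ 1`. -/
noncomputable def Lfun (ℋ : Set ThreeGraph) (ε₁ : ℝ) (ε₂ : ℕ → ℝ) : ℕ :=
  sInf {L : ℕ | ∃ T : ℕ, 1 ≤ T ∧ psi ε₁ ε₂ T L ℋ}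

def InZeroOne (f : ℕ → ℝ) : Prop := ∀ x, 0 < f x ∧ f x ≤ 1

/-- "For all sufficiently small `ε₁ > 0` and all `ε₂` tending to `0` sufficiently fast, `Φ`". -/
def SmallEps (Φ : ℝ → (ℕ → ℝ) → Prop) : Prop :=
  ∃ e₁ : ℝ, 0 < e₁ ∧ ∀ ε₁ : ℝ, 0 < ε₁ → ε₁ < e₁ →
    ∃ δ : ℕ → ℝ, InZeroOne δ ∧
      ∀ ε₂ : ℕ → ℝ, InZeroOne ε₂ → (∀ x, ε₂ x ≤ δ x) → Φ ε₁ ε₂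

/-- The `VC₂`-dimension of `H` is at least `k`. -/
def ThreeGraph.VC2AtLeast (H : ThreeGraph) (k : ℕ) : Prop :=
  ∃ a b : Fin k → ℕ, ∃ c : Finset (Fin k × Fin k) → ℕ,
    (∀ i, a i ∈ H.verts) ∧ (∀ i, b i ∈ H.verts) ∧ (∀ S, c S ∈ H.verts) ∧
    ∀ (i j : Fin k) (S : Finset (Fin k × Fin k)),
      (({a i, b j, c S} : Finset ℕ) ∈ H.edges ↔ (i, j) ∈ S)

/-- `K₃[A,B,C]`: the triples meeting each of `A`, `B`, `C`. -/
def K3Parts (A B C : Finset ℕ) : Finset (Finset ℕ) :=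
  (A ×ˢ B ×ˢ C).image fun p => ({p.1, p.2.1, p.2.2} : Finset ℕ)

/-- Neighborhood of `u` in the pair-set `W`, inside ambient set `V`. -/
def Nbhd (V : Finset ℕ) (W : Finset (ℕ × ℕ)) (u : ℕ) : Finset ℕ :=
  V.filter fun v => (u, v) ∈ W

/-- An edge-colored bigraph `(U,V;E₀,E₁,E₂)`. -/
structure ECBigraph where
  left : Finset ℕ
  right : Finset ℕ
  E0 : Finset (ℕ × ℕ)
  E1 : Finset (ℕ × ℕ)
  E2 : Finset (ℕ × ℕ)
  disj01 : Disjoint E0 E1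
  disj02 : Disjoint E0 E2
  disj12 : Disjoint E1 E2
  cover : E0 ∪ E1 ∪ E2 = left ×ˢ right

/-- `G` contains an `E₀/E₁`-copy of `U_bg(k)`. -/
def ECBigraph.CopyUbg (G : ECBigraph) (k : ℕ) : Prop :=
  ∃ u : Finset (Fin k) → ℕ, ∃ v : Fin k → ℕ,
    (∀ S, u S ∈ G.left) ∧ (∀ i, v i ∈ G.right) ∧
    ∀ (S : Finset (Fin k)) (i : Fin k),
      (i ∈ S → (u S, v i) ∈ G.E1) ∧ (i ∉ S → (u S, v i) ∈ G.E0)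

/-- `G` contains an `E₀/E₁`-copy of the bigraph `R`. -/
def ECBigraph.Copy01 (G : ECBigraph) (R : Bigraph) : Prop :=
  ∃ u v : ℕ → ℕ,
    (∀ a ∈ R.left, u a ∈ G.left) ∧ (∀ b ∈ R.right, v b ∈ G.right) ∧
    ∀ a ∈ R.left, ∀ b ∈ R.right,
      ((a, b) ∈ R.edges → (u a, v b) ∈ G.E1) ∧ ((a, b) ∉ R.edges → (u a, v b) ∈ G.E0)

/-- `K₂[A,B]`: the crossing (unordered) pairs. -/
def pairsAB (A B : Finset ℕ) : Finset (Finset ℕ) :=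
  (A ×ˢ B).image fun p => ({p.1, p.2} : Finset ℕ)

/-- A bipartite `U`-colored graph `Γ = (A ∪ B, (P_u)_{u ∈ U})`. -/
structure BipColored (U : Finset ℕ) where
  A : Finset ℕ
  B : Finset ℕ
  disjAB : Disjoint A B
  P : ℕ → Finset (Finset ℕ)
  P_disj : ∀ u ∈ U, ∀ u' ∈ U, u ≠ u' → Disjoint (P u) (P u')
  P_cover : U.biUnion P = pairsAB A B

/-- The bipartite graph `(A ∪ B, P_u)` of a color, as a bigraph (ordered pairs `P̄_u`). -/
def BipColored.colorBG {U : Finset ℕ} (Γ : BipColored U) (u : ℕ) : Bigraph where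
  left := Γ.A
  right := Γ.B
  edges := (Γ.A ×ˢ Γ.B).filter fun p => ({p.1, p.2} : Finset ℕ) ∈ Γ.P u
  edges_sub := Finset.filter_subset _ _

/-- `H` is an `(n,Γ)`-blowup of `G` with the explicit family `Cfam` of new vertex classes. -/
def IsBlowupWith (G : Bigraph) (n : ℕ) (Γ : BipColored G.left) (Cfam : ℕ → Finset ℕ)
    (H : ThreeGraph) : Prop :=
  (∀ v ∈ G.right, (Cfam v).card = n) ∧
  (∀ v ∈ G.right, ∀ v' ∈ G.right, v ≠ v' → Disjoint (Cfam v) (Cfam v')) ∧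
  (∀ v ∈ G.right, Disjoint (Cfam v) (Γ.A ∪ Γ.B)) ∧
  H.verts = Γ.A ∪ Γ.B ∪ G.right.biUnion Cfam ∧
  ∀ u ∈ G.left, ∀ v ∈ G.right, ∀ e ∈ Γ.P u, ∀ z ∈ Cfam v,
    (((u, v) ∈ G.edges → insert z e ∈ H.edges) ∧ ((u, v) ∉ G.edges → insert z e ∉ H.edges))

def IsBlowup (G : Bigraph) (n : ℕ) (Γ : BipColored G.left) (H : ThreeGraph) : Prop :=
  ∃ Cfam : ℕ → Finset ℕ, IsBlowupWith G n Γ Cfam H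

def ThreeGraph.ContainsInduced (H H' : ThreeGraph) : Prop :=
  ∃ W : Finset ℕ, ThreeGraph.Iso (H.induce W) H'

/-- The `G`-dimension of `H` is at least `n`. -/
def GDimAtLeast (G : Bigraph) (H : ThreeGraph) (n : ℕ) : Prop :=
  ∀ Γ : BipColored G.left, Γ.A.card = n → Γ.B.card = n →
    ∃ H' : ThreeGraph, IsBlowup G n Γ H' ∧ H.ContainsInduced H'

/-- `G ∈ B_ℋ`: `G` is irreducible and `ℋ` has infinite `G`-dimension. -/
def InBH (ℋ : Set ThreeGraph) (G : Bigraph) : Prop :=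
  G.Irreducible ∧ ∀ m : ℕ, ∃ H ∈ ℋ, GDimAtLeast G H m

/-- An encoding of the bigraph `R` in `(H,P)`, where `Rtrip = Ē(H)`. -/
def Encoding {V : Finset ℕ} {t ℓ : ℕ} (R : Bigraph) (Rtrip : Finset (ℕ × ℕ × ℕ))
    (P : Decomp V (Fin t) (Fin ℓ)) (ε₂ : ℝ) : Prop :=
  ∃ j₀ k₀ : Fin t, j₀ ≠ k₀ ∧
    ∃ f : ℕ → Fin ℓ, ∃ g : ℕ → Fin t × Fin ℓ × Fin ℓ,
      (∀ u ∈ R.left, (P.pairBG j₀ k₀ (f u)).dev2 ε₂ (1 / (ℓ : ℝ))) ∧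
      (∀ v ∈ R.right,
        (P.pairBG (g v).1 j₀ (g v).2.1).dev2 ε₂ (1 / (ℓ : ℝ)) ∧
        (P.pairBG (g v).1 k₀ (g v).2.2).dev2 ε₂ (1 / (ℓ : ℝ))) ∧
      ∀ u ∈ R.left, ∀ v ∈ R.right,
        (((u, v) ∈ R.edges →
          ((P.triadOf (g v).1 j₀ k₀ (g v).2.1 (g v).2.2 (f u)).K3.card : ℝ) / 2 ≤
            ((Rtrip ∩ (P.triadOf (g v).1 j₀ k₀ (g v).2.1 (g v).2.2 (f u)).K3).card : ℝ)) ∧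
         ((u, v) ∉ R.edges →
          ((Rtrip ∩ (P.triadOf (g v).1 j₀ k₀ (g v).2.1 (g v).2.2 (f u)).K3).card : ℝ) <
            ((P.triadOf (g v).1 j₀ k₀ (g v).2.1 (g v).2.2 (f u)).K3.card : ℝ) / 2))

def encodeSet (S : Finset ℕ) : ℕ := ∑ i ∈ S, 2 ^ i

/-- The bigraph `U_bg(k)` realized on `ℕ`, with subsets of `[k]` encoded in binary. -/
def Ubg (k : ℕ) : Bigraph where
  left := ((Finset.range k).powerset).image encodeSet
  right := Finset.range k
  edges := ((Finset.range k).powerset).biUnion fun S => S.image fun i => (encodeSet S, i)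
  edges_sub := by
    intro p hp
    simp only [Finset.mem_biUnion, Finset.mem_image, Finset.mem_powerset] at hp
    obtain ⟨S, hS, i, hi, rfl⟩ := hp
    refine Finset.mem_product.mpr ⟨?_, ?_⟩
    · exact Finset.mem_image.mpr ⟨S, Finset.mem_powerset.mpr hS, rfl⟩
    · exact hS hi

/-- The four-cycle (Gowers box) sum of a weight on `X × Y`. -/
noncomputable def boxSum (X Y : Finset ℕ) (g : ℕ → ℕ → ℝ) : ℝ :=
  ∑ x₀ ∈ X, ∑ x₁ ∈ X, ∑ y₀ ∈ Y, ∑ y₁ ∈ Y, g x₀ y₀ * g x₀ y₁ * g x₁ y₀ * g x₁ y₁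

lemma boxSum_eq_sum_sq (X Y : Finset ℕ) (g : ℕ → ℕ → ℝ) :
    boxSum X Y g = ∑ x₀ ∈ X, ∑ x₁ ∈ X, (∑ y ∈ Y, g x₀ y * g x₁ y) ^ 2 := by
  unfold boxSum
  refine Finset.sum_congr rfl fun x₀ _ => Finset.sum_congr rfl fun x₁ _ => ?_
  rw [sq, Finset.sum_mul_sum]
  refine Finset.sum_congr rfl fun y₀ _ => Finset.sum_congr rfl fun y₁ _ => ?_
  ring

lemma boxSum_nonneg (X Y : Finset ℕ) (g : ℕ → ℕ → ℝ) : 0 ≤ boxSum X Y g := by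
  rw [boxSum_eq_sum_sq]
  positivity

/-- Two applications of the Cauchy–Schwarz inequality. -/
lemma sum_pow_four_le_boxSum (X Y : Finset ℕ) (g : ℕ → ℕ → ℝ) (a b : ℕ → ℝ)
    (ha : ∀ x, |a x| ≤ 1) (hb : ∀ y, |b y| ≤ 1) :
    (∑ x ∈ X, ∑ y ∈ Y, g x y * a x * b y) ^ 4 ≤
      (X.card : ℝ) ^ 2 * (Y.card : ℝ) ^ 2 * boxSum X Y g := by
  have h1 : (∑ x ∈ X, ∑ y ∈ Y, g x y * a x * b y) ^ 2 ≤
      (Y.card : ℝ) * ∑ y ∈ Y, (∑ x ∈ X, g x y * a x) ^ 2 := by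
    rw [Finset.sum_comm]
    calc (∑ y ∈ Y, ∑ x ∈ X, g x y * a x * b y) ^ 2
        ≤ Y.card * ∑ y ∈ Y, (∑ x ∈ X, g x y * a x * b y) ^ 2 := sq_sum_le_card_mul_sum_sq
      _ ≤ _ := by
          refine mul_le_mul_of_nonneg_left (Finset.sum_le_sum fun y _ => ?_) (by positivity)
          rw [← Finset.sum_mul, mul_pow]
          have : b y ^ 2 ≤ 1 := (sq_le_one_iff_abs_le_one _).2 (hb y)
          nlinarith [sq_nonneg (∑ x ∈ X, g x y * a x)]
  have h2 : ∑ y ∈ Y, (∑ x ∈ X, g x y * a x) ^ 2 =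
      ∑ x₀ ∈ X, ∑ x₁ ∈ X, a x₀ * a x₁ * ∑ y ∈ Y, g x₀ y * g x₁ y := by
    simp_rw [sq, Finset.sum_mul_sum, Finset.mul_sum]
    rw [Finset.sum_comm]
    refine Finset.sum_congr rfl fun x₀ _ => ?_
    rw [Finset.sum_comm]
    refine Finset.sum_congr rfl fun x₁ _ => Finset.sum_congr rfl fun y _ => ?_
    ring
  have h3 : (∑ x₀ ∈ X, ∑ x₁ ∈ X, a x₀ * a x₁ * ∑ y ∈ Y, g x₀ y * g x₁ y) ^ 2 ≤
      (X.card : ℝ) ^ 2 * boxSum X Y g := by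
    rw [boxSum_eq_sum_sq, ← Finset.sum_product', ← Finset.sum_product']
    refine sq_sum_le_card_mul_sum_sq.trans ?_
    rw [Finset.card_product]
    push_cast
    rw [← sq]
    refine mul_le_mul_of_nonneg_left (Finset.sum_le_sum fun p _ => ?_) (by positivity)
    rw [mul_pow]
    have h : |a p.1 * a p.2| ≤ 1 := by
      rw [abs_mul]
      exact mul_le_one₀ (ha _) (abs_nonneg _) (ha _)
    have : (a p.1 * a p.2) ^ 2 ≤ 1 := (sq_le_one_iff_abs_le_one _).2 h
    nlinarith [sq_nonneg (∑ y ∈ Y, g p.1 y * g p.2 y)]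
  calc (∑ x ∈ X, ∑ y ∈ Y, g x y * a x * b y) ^ 4
      = ((∑ x ∈ X, ∑ y ∈ Y, g x y * a x * b y) ^ 2) ^ 2 := by ring
    _ ≤ ((Y.card : ℝ) * ∑ y ∈ Y, (∑ x ∈ X, g x y * a x) ^ 2) ^ 2 := by gcongr
    _ = (Y.card : ℝ) ^ 2 * (∑ y ∈ Y, (∑ x ∈ X, g x y * a x) ^ 2) ^ 2 := by ring
    _ ≤ (Y.card : ℝ) ^ 2 * ((X.card : ℝ) ^ 2 * boxSum X Y g) := by
        rw [h2]
        gcongr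
    _ = _ := by ring

lemma abs_sum_le_of_boxSum_le {X Y : Finset ℕ} {g : ℕ → ℕ → ℝ} {e : ℝ} (he : 0 ≤ e)
    (hg : boxSum X Y g ≤ e ^ 4 * (X.card : ℝ) ^ 2 * (Y.card : ℝ) ^ 2) {a b : ℕ → ℝ}
    (ha : ∀ x, |a x| ≤ 1) (hb : ∀ y, |b y| ≤ 1) :
    |∑ x ∈ X, ∑ y ∈ Y, g x y * a x * b y| ≤ e * X.card * Y.card := by
  refine le_of_pow_le_pow_left₀ (n := 4) (by norm_num) (by positivity) ?_
  rw [Even.pow_abs (by decide)]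
  refine (sum_pow_four_le_boxSum X Y g a b ha hb).trans ?_
  calc (X.card : ℝ) ^ 2 * (Y.card : ℝ) ^ 2 * boxSum X Y g
      ≤ (X.card : ℝ) ^ 2 * (Y.card : ℝ) ^ 2 *
        (e ^ 4 * (X.card : ℝ) ^ 2 * (Y.card : ℝ) ^ 2) := by gcongr
    _ = _ := by ring

lemma abs_sum_le_card_mul {ι : Type*} (s : Finset ι) (f : ι → ℝ) {c : ℝ}
    (h : ∀ i ∈ s, |f i| ≤ c) : |∑ i ∈ s, f i| ≤ s.card * c := by
  refine (Finset.abs_sum_le_sum_abs _ _).trans ((Finset.sum_le_card_nsmul _ _ _ h).trans ?_)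
  rw [nsmul_eq_mul]

/-- The octahedral deviation sum dominates its restriction to any set of first coordinates. -/
lemma sum_sq_le_devSum3 (R : Finset (ℕ × ℕ × ℕ)) (G : Triad) {X' : Finset ℕ} (hX : X' ⊆ G.X) :
    ∑ y₀ ∈ G.Y, ∑ y₁ ∈ G.Y, ∑ z₀ ∈ G.Z, ∑ z₁ ∈ G.Z,
      (∑ x ∈ X', hFun R G x y₀ z₀ * hFun R G x y₀ z₁ * hFun R G x y₁ z₀ * hFun R G x y₁ z₁) ^ 2
      ≤ devSum3 R G := by
  have key : devSum3 R G = ∑ x₀ ∈ G.X, ∑ x₁ ∈ G.X,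
      boxSum G.Y G.Z fun y z => hFun R G x₀ y z * hFun R G x₁ y z := by
    unfold devSum3 boxSum
    refine Finset.sum_congr rfl fun x₀ _ => Finset.sum_congr rfl fun x₁ _ =>
      Finset.sum_congr rfl fun y₀ _ => Finset.sum_congr rfl fun y₁ _ =>
      Finset.sum_congr rfl fun z₀ _ => Finset.sum_congr rfl fun z₁ _ => ?_
    ring
  rw [key]
  calc _ = ∑ x₀ ∈ X', ∑ x₁ ∈ X',
        boxSum G.Y G.Z fun y z => hFun R G x₀ y z * hFun R G x₁ y z := by
        unfold boxSum
        simp_rw [sq, Finset.sum_mul_sum, ← Finset.sum_product']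
        refine Finset.sum_nbij'
          (fun p => (p.2.2.2.2.1, p.2.2.2.2.2, p.1, p.2.1, p.2.2.1, p.2.2.2.1))
          (fun p => (p.2.2.1, p.2.2.2.1, p.2.2.2.2.1, p.2.2.2.2.2, p.1, p.2.1))
          ?_ ?_ (fun _ _ => rfl) (fun _ _ => rfl) (fun _ _ => by ring)
        · simp only [Finset.mem_product]
          tauto
        · simp only [Finset.mem_product]
          tauto
    _ ≤ ∑ x₀ ∈ X', ∑ x₁ ∈ G.X,
        boxSum G.Y G.Z fun y z => hFun R G x₀ y z * hFun R G x₁ y z := by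
        refine Finset.sum_le_sum fun x _ => ?_
        exact Finset.sum_le_sum_of_subset_of_nonneg hX fun _ _ _ => boxSum_nonneg _ _ _
    _ ≤ _ := Finset.sum_le_sum_of_subset_of_nonneg hX fun _ _ _ =>
        Finset.sum_nonneg fun _ _ => boxSum_nonneg _ _ _

/-- In a product of two quasirandom bigraphs, the four-cycles of any weight `q` on the base have
the expected number of common neighbours. -/
lemma abs_codegree_sum_sub_le {X Y Z : Finset ℕ} {p r q : ℕ → ℕ → ℝ} {u : ℕ → ℝ} {a b e : ℝ}
    (he : 0 ≤ e) (hp : ∀ x y, |p x y| ≤ 1) (hr : ∀ x y, |r x y| ≤ 1) (hq : ∀ x y, |q x y| ≤ 1)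
    (hu : ∀ x, |u x| ≤ 1) (ha : |a| ≤ 1) (hb : |b| ≤ 1)
    (hP : boxSum X Y (fun x y => p x y - a) ≤ e ^ 4 * (X.card : ℝ) ^ 2 * (Y.card : ℝ) ^ 2)
    (hR : boxSum X Z (fun x z => r x z - b) ≤ e ^ 4 * (X.card : ℝ) ^ 2 * (Z.card : ℝ) ^ 2) :
    |∑ y₀ ∈ Y, ∑ y₁ ∈ Y, ∑ z₀ ∈ Z, ∑ z₁ ∈ Z, (q y₀ z₀ * q y₀ z₁ * q y₁ z₀ * q y₁ z₁) *
        (∑ x ∈ X, u x * (p x y₀ * p x y₁ * r x z₀ * r x z₁)) -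
      a ^ 2 * b ^ 2 * (∑ x ∈ X, u x) * boxSum Y Z q| ≤
      4 * (e * X.card * (Y.card : ℝ) ^ 2 * (Z.card : ℝ) ^ 2) := by
  have hm : ∀ {s t : ℝ}, |s| ≤ 1 → |t| ≤ 1 → |s * t| ≤ 1 := fun {s t} hs ht => by
    rw [abs_mul]
    exact mul_le_one₀ hs (abs_nonneg _) ht
  have hqq : ∀ y₀ y₁ z₀ z₁, |q y₀ z₀ * q y₀ z₁ * q y₁ z₀ * q y₁ z₁| ≤ 1 := fun y₀ y₁ z₀ z₁ =>
    hm (hm (hm (hq _ _) (hq _ _)) (hq _ _)) (hq _ _)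
  have bound : ∀ (A B C : Finset ℕ) (F : ℕ → ℕ → ℕ → ℝ) (c : ℝ),
      (∀ i j k, |F i j k| ≤ c) → |∑ i ∈ A, ∑ j ∈ B, ∑ k ∈ C, F i j k| ≤
        A.card * (B.card * (C.card * c)) := fun A B C F c h =>
    abs_sum_le_card_mul _ _ fun i _ => abs_sum_le_card_mul _ _ fun j _ =>
      abs_sum_le_card_mul _ _ fun k _ => h i j k
  have h1 : |∑ y₁ ∈ Y, ∑ z₀ ∈ Z, ∑ z₁ ∈ Z, ∑ x ∈ X, ∑ y₀ ∈ Y, (p x y₀ - a) *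
      (u x * p x y₁ * r x z₀ * r x z₁) * (q y₀ z₀ * q y₀ z₁ * q y₁ z₀ * q y₁ z₁)| ≤
      Y.card * (Z.card * (Z.card * (e * X.card * Y.card))) :=
    bound _ _ _ _ _ fun y₁ z₀ z₁ => abs_sum_le_of_boxSum_le he hP
      (a := fun x => u x * p x y₁ * r x z₀ * r x z₁)
      (b := fun y₀ => q y₀ z₀ * q y₀ z₁ * q y₁ z₀ * q y₁ z₁)
      (fun x => hm (hm (hm (hu x) (hp _ _)) (hr _ _)) (hr _ _)) (fun _ => hqq _ _ _ _)
  have h2 : |∑ y₀ ∈ Y, ∑ z₀ ∈ Z, ∑ z₁ ∈ Z, ∑ x ∈ X, ∑ y₁ ∈ Y, (p x y₁ - a) *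
      (a * u x * r x z₀ * r x z₁) * (q y₀ z₀ * q y₀ z₁ * q y₁ z₀ * q y₁ z₁)| ≤
      Y.card * (Z.card * (Z.card * (e * X.card * Y.card))) :=
    bound _ _ _ _ _ fun y₀ z₀ z₁ => abs_sum_le_of_boxSum_le he hP
      (a := fun x => a * u x * r x z₀ * r x z₁)
      (b := fun y₁ => q y₀ z₀ * q y₀ z₁ * q y₁ z₀ * q y₁ z₁)
      (fun x => hm (hm (hm ha (hu x)) (hr _ _)) (hr _ _)) (fun _ => hqq _ _ _ _)
  have h3 : |∑ y₀ ∈ Y, ∑ y₁ ∈ Y, ∑ z₁ ∈ Z, ∑ x ∈ X, ∑ z₀ ∈ Z, (r x z₀ - b) *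
      (a * a * u x * r x z₁) * (q y₀ z₀ * q y₀ z₁ * q y₁ z₀ * q y₁ z₁)| ≤
      Y.card * (Y.card * (Z.card * (e * X.card * Z.card))) :=
    bound _ _ _ _ _ fun y₀ y₁ z₁ => abs_sum_le_of_boxSum_le he hR
      (a := fun x => a * a * u x * r x z₁)
      (b := fun z₀ => q y₀ z₀ * q y₀ z₁ * q y₁ z₀ * q y₁ z₁)
      (fun x => hm (hm (hm ha ha) (hu x)) (hr _ _)) (fun _ => hqq _ _ _ _)
  have h4 : |∑ y₀ ∈ Y, ∑ y₁ ∈ Y, ∑ z₀ ∈ Z, ∑ x ∈ X, ∑ z₁ ∈ Z, (r x z₁ - b) *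
      (a * a * b * u x) * (q y₀ z₀ * q y₀ z₁ * q y₁ z₀ * q y₁ z₁)| ≤
      Y.card * (Y.card * (Z.card * (e * X.card * Z.card))) :=
    bound _ _ _ _ _ fun y₀ y₁ z₀ => abs_sum_le_of_boxSum_le he hR
      (a := fun x => a * a * b * u x)
      (b := fun z₁ => q y₀ z₀ * q y₀ z₁ * q y₁ z₀ * q y₁ z₁)
      (fun x => hm (hm (hm ha ha) hb) (hu x)) (fun _ => hqq _ _ _ _)
  have rot : ∀ (A B C D E : Finset ℕ) (F : ℕ → ℕ → ℕ → ℕ → ℕ → ℝ),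
      ∑ i ∈ A, ∑ j ∈ B, ∑ k ∈ C, ∑ l ∈ D, ∑ m ∈ E, F i j k l m =
        ∑ m ∈ E, ∑ i ∈ A, ∑ j ∈ B, ∑ k ∈ C, ∑ l ∈ D, F i j k l m := fun A B C D E F => by
    calc _ = ∑ i ∈ A, ∑ j ∈ B, ∑ k ∈ C, ∑ m ∈ E, ∑ l ∈ D, F i j k l m :=
          Finset.sum_congr rfl fun i _ => Finset.sum_congr rfl fun j _ =>
            Finset.sum_congr rfl fun k _ => Finset.sum_comm
      _ = ∑ i ∈ A, ∑ j ∈ B, ∑ m ∈ E, ∑ k ∈ C, ∑ l ∈ D, F i j k l m :=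
          Finset.sum_congr rfl fun i _ => Finset.sum_congr rfl fun j _ => Finset.sum_comm
      _ = ∑ i ∈ A, ∑ m ∈ E, ∑ j ∈ B, ∑ k ∈ C, ∑ l ∈ D, F i j k l m :=
          Finset.sum_congr rfl fun i _ => Finset.sum_comm
      _ = _ := Finset.sum_comm
  have rot' : ∀ (B C D E : Finset ℕ) (F : ℕ → ℕ → ℕ → ℕ → ℝ),
      ∑ j ∈ B, ∑ k ∈ C, ∑ l ∈ D, ∑ m ∈ E, F j k l m =
        ∑ m ∈ E, ∑ j ∈ B, ∑ k ∈ C, ∑ l ∈ D, F j k l m := fun B C D E F => by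
    calc _ = ∑ j ∈ B, ∑ k ∈ C, ∑ m ∈ E, ∑ l ∈ D, F j k l m :=
          Finset.sum_congr rfl fun j _ => Finset.sum_congr rfl fun k _ => Finset.sum_comm
      _ = ∑ j ∈ B, ∑ m ∈ E, ∑ k ∈ C, ∑ l ∈ D, F j k l m :=
          Finset.sum_congr rfl fun j _ => Finset.sum_comm
      _ = _ := Finset.sum_comm
  have rot'' : ∀ (C D E : Finset ℕ) (F : ℕ → ℕ → ℕ → ℝ),
      ∑ k ∈ C, ∑ l ∈ D, ∑ m ∈ E, F k l m = ∑ m ∈ E, ∑ k ∈ C, ∑ l ∈ D, F k l m :=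
    fun C D E F => by
    calc _ = ∑ k ∈ C, ∑ m ∈ E, ∑ l ∈ D, F k l m :=
          Finset.sum_congr rfl fun k _ => Finset.sum_comm
      _ = _ := Finset.sum_comm
  rw [rot] at h1
  have e2 := fun y₀ => rot' Z Z X Y (fun z₀ z₁ x y₁ => (p x y₁ - a) *
      (a * u x * r x z₀ * r x z₁) * (q y₀ z₀ * q y₀ z₁ * q y₁ z₀ * q y₁ z₁))
  have e3 := fun y₀ y₁ => rot'' Z X Z (fun z₁ x z₀ => (r x z₀ - b) *
      (a * a * u x * r x z₁) * (q y₀ z₀ * q y₀ z₁ * q y₁ z₀ * q y₁ z₁))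
  simp only [e2] at h2
  simp only [e3] at h3
  have e4 : ∀ y₀ y₁ z₀, ∑ x ∈ X, ∑ z₁ ∈ Z, (r x z₁ - b) *
      (a * a * b * u x) * (q y₀ z₀ * q y₀ z₁ * q y₁ z₀ * q y₁ z₁) = ∑ z₁ ∈ Z, ∑ x ∈ X,
      (r x z₁ - b) * (a * a * b * u x) * (q y₀ z₀ * q y₀ z₁ * q y₁ z₀ * q y₁ z₁) :=
    fun _ _ _ => Finset.sum_comm
  simp only [e4] at h4
  have split : ∑ y₀ ∈ Y, ∑ y₁ ∈ Y, ∑ z₀ ∈ Z, ∑ z₁ ∈ Z,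
        (q y₀ z₀ * q y₀ z₁ * q y₁ z₀ * q y₁ z₁) *
        (∑ x ∈ X, u x * (p x y₀ * p x y₁ * r x z₀ * r x z₁)) -
      a ^ 2 * b ^ 2 * (∑ x ∈ X, u x) * boxSum Y Z q =
      (∑ y₀ ∈ Y, ∑ y₁ ∈ Y, ∑ z₀ ∈ Z, ∑ z₁ ∈ Z, ∑ x ∈ X, (p x y₀ - a) *
        (u x * p x y₁ * r x z₀ * r x z₁) * (q y₀ z₀ * q y₀ z₁ * q y₁ z₀ * q y₁ z₁)) +
      (∑ y₀ ∈ Y, ∑ y₁ ∈ Y, ∑ z₀ ∈ Z, ∑ z₁ ∈ Z, ∑ x ∈ X, (p x y₁ - a) *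
        (a * u x * r x z₀ * r x z₁) * (q y₀ z₀ * q y₀ z₁ * q y₁ z₀ * q y₁ z₁)) +
      (∑ y₀ ∈ Y, ∑ y₁ ∈ Y, ∑ z₀ ∈ Z, ∑ z₁ ∈ Z, ∑ x ∈ X, (r x z₀ - b) *
        (a * a * u x * r x z₁) * (q y₀ z₀ * q y₀ z₁ * q y₁ z₀ * q y₁ z₁)) +
      (∑ y₀ ∈ Y, ∑ y₁ ∈ Y, ∑ z₀ ∈ Z, ∑ z₁ ∈ Z, ∑ x ∈ X, (r x z₁ - b) *
        (a * a * b * u x) * (q y₀ z₀ * q y₀ z₁ * q y₁ z₀ * q y₁ z₁)) := by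
    unfold boxSum
    simp only [Finset.mul_sum, ← Finset.sum_sub_distrib, ← Finset.sum_add_distrib]
    refine Finset.sum_congr rfl fun y₀ _ => Finset.sum_congr rfl fun y₁ _ =>
      Finset.sum_congr rfl fun z₀ _ => Finset.sum_congr rfl fun z₁ _ => ?_
    rw [Finset.sum_mul, ← Finset.sum_sub_distrib]
    refine Finset.sum_congr rfl fun x _ => ?_
    ring
  rw [split]
  refine (abs_add_le _ _).trans ?_
  refine (add_le_add ((abs_add_le _ _).trans (add_le_add (abs_add_le _ _) le_rfl)) le_rfl).trans ?_
  linarith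

/-- The `0/1` indicator of a set of pairs. -/
noncomputable def pairInd (E : Finset (ℕ × ℕ)) (x y : ℕ) : ℝ := if (x, y) ∈ E then 1 else 0

lemma pairInd_nonneg (E : Finset (ℕ × ℕ)) (x y : ℕ) : 0 ≤ pairInd E x y := by
  unfold pairInd
  split_ifs <;> norm_num

lemma pairInd_le_one (E : Finset (ℕ × ℕ)) (x y : ℕ) : pairInd E x y ≤ 1 := by
  unfold pairInd
  split_ifs <;> norm_num

lemma abs_pairInd_le_one (E : Finset (ℕ × ℕ)) (x y : ℕ) : |pairInd E x y| ≤ 1 := by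
  rw [abs_of_nonneg (pairInd_nonneg E x y)]
  exact pairInd_le_one E x y

lemma sum_pairInd {E : Finset (ℕ × ℕ)} {Y Z : Finset ℕ} (h : E ⊆ Y ×ˢ Z) :
    ∑ y ∈ Y, ∑ z ∈ Z, pairInd E y z = E.card := by
  rw [← Finset.sum_product']
  unfold pairInd
  rw [Finset.sum_boole]
  congr 2
  ext p
  simpa using fun hp => Finset.mem_product.1 (h hp)

lemma Bigraph.devSum_eq_boxSum (B : Bigraph) :
    B.devSum = boxSum B.left B.right fun x y => pairInd B.edges x y - B.density := by
  have h : ∀ u w, B.gfun u w = pairInd B.edges u w - B.density := fun u w => by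
    unfold Bigraph.gfun pairInd
    split_ifs <;> ring
  simp only [Bigraph.devSum, h, boxSum]

lemma Bigraph.density_le_one (B : Bigraph) : B.density ≤ 1 := by
  unfold Bigraph.density
  refine div_le_one_of_le₀ ?_ (by positivity)
  have := Finset.card_le_card B.edges_sub
  rw [Finset.card_product] at this
  exact_mod_cast this

lemma Bigraph.card_pos_of_density_pos {B : Bigraph} (h : 0 < B.density) :
    0 < (B.left.card : ℝ) ∧ 0 < (B.right.card : ℝ) := by
  constructor <;>
  · refine lt_of_le_of_ne (by positivity) fun h0 => ?_
    rw [Bigraph.density, ← h0] at h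
    simp at h

lemma Bigraph.card_edges_eq {B : Bigraph} (h : 0 < B.density) :
    (B.edges.card : ℝ) = B.density * (B.left.card * B.right.card) := by
  obtain ⟨h1, h2⟩ := card_pos_of_density_pos h
  unfold Bigraph.density
  field_simp

/-- If the balanced function of a quasirandom triad has constant sign on the triangles over a set
`Q` of base pairs and a set `X'` of apices, then `Q` is small or that sign has small weight. -/
lemma dev23.card_pow_le {R : Finset (ℕ × ℕ × ℕ)} {G : Triad} {X' : Finset ℕ}
    {Q : Finset (ℕ × ℕ)} {c δ ε₁ ε₂ : ℝ} (hdev : dev23 R G ε₁ ε₂) (hX : X' ⊆ G.X)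
    (hQ : Q ⊆ G.EYZ)
    (hh : ∀ x ∈ X', ∀ y z, (y, z) ∈ Q →
      hFun R G x y z = c * (pairInd G.EXY x y * pairInd G.EXZ x z))
    (hε₁ : 0 ≤ ε₁) (hδ : 0 < δ) (hδ1 : δ ≤ 1) (hε₂ : ε₂ ≤ (δ ^ 13 / 8) ^ 4)
    (hXY : δ ≤ G.bXY.density) (hXZ : δ ≤ G.bXZ.density) (hYZ : δ ≤ G.bYZ.density)
    (hX' : δ * G.X.card ≤ X'.card) (hQ' : δ * G.EYZ.card ≤ Q.card) :
    c ^ 8 * (X'.card : ℝ) ^ 2 * (Q.card : ℝ) ^ 4 ≤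
      2 ^ 14 * ε₁ * (G.X.card : ℝ) ^ 2 * (G.EYZ.card : ℝ) ^ 4 := by
  obtain ⟨d₁, d₃, d₂, hd₁, hd₃, hd₂, ⟨hXY1, hXY2⟩, ⟨hXZ1, hXZ2⟩, ⟨hYZ1, -⟩, hoct⟩ := hdev
  have hε₂δ : ε₂ ≤ δ := by
    refine hε₂.trans ?_
    have h1 : δ ^ 13 / 8 ≤ δ := by
      have : δ ^ 13 ≤ δ ^ 1 := pow_le_pow_of_le_one hδ.le hδ1 (by norm_num)
      linarith
    calc (δ ^ 13 / 8) ^ 4 ≤ δ ^ 4 := by gcongr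
      _ ≤ δ ^ 1 := pow_le_pow_of_le_one hδ.le hδ1 (by norm_num)
      _ = δ := pow_one δ
  obtain ⟨hx0, hy0⟩ := Bigraph.card_pos_of_density_pos (hδ.trans_le hXY)
  obtain ⟨-, hz0⟩ := Bigraph.card_pos_of_density_pos (hδ.trans_le hXZ)
  have hcard := Bigraph.card_edges_eq (hδ.trans_le hYZ)
  change 0 < (G.X.card : ℝ) at hx0
  change 0 < (G.Y.card : ℝ) at hy0
  change 0 < (G.Z.card : ℝ) at hz0
  change (G.EYZ.card : ℝ) = _ * (G.Y.card * G.Z.card : ℝ) at hcard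
  set a := G.bXY.density
  set b := G.bXZ.density
  set f := G.bYZ.density
  have ha0 : 0 < a := hδ.trans_le hXY
  have hb0 : 0 < b := hδ.trans_le hXZ
  have ha1 : a ≤ 1 := Bigraph.density_le_one _
  have hb1 : b ≤ 1 := Bigraph.density_le_one _
  have hd₁a : d₁ ≤ 2 * a := by linarith [(abs_le.1 hXY1).1]
  have hd₂b : d₂ ≤ 2 * b := by linarith [(abs_le.1 hXZ1).1]
  have hd₃f : d₃ ≤ 2 * f := by linarith [(abs_le.1 hYZ1).1]
  have hP : boxSum G.X G.Y (fun x y => pairInd G.EXY x y - a) ≤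
      (δ ^ 13 / 8) ^ 4 * (G.X.card : ℝ) ^ 2 * (G.Y.card : ℝ) ^ 2 := by
    have := G.bXY.devSum_eq_boxSum
    change _ = boxSum G.X G.Y (fun x y => pairInd G.EXY x y - a) at this
    rw [← this]
    refine hXY2.trans ?_
    change ε₂ * (G.X.card : ℝ) ^ 2 * (G.Y.card : ℝ) ^ 2 ≤ _
    gcongr
  have hR : boxSum G.X G.Z (fun x y => pairInd G.EXZ x y - b) ≤
      (δ ^ 13 / 8) ^ 4 * (G.X.card : ℝ) ^ 2 * (G.Z.card : ℝ) ^ 2 := by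
    have := G.bXZ.devSum_eq_boxSum
    change _ = boxSum G.X G.Z (fun x y => pairInd G.EXZ x y - b) at this
    rw [← this]
    refine hXZ2.trans ?_
    change ε₂ * (G.X.card : ℝ) ^ 2 * (G.Z.card : ℝ) ^ 2 ≤ _
    gcongr
  have hT := abs_codegree_sum_sub_le (q := pairInd Q) (u := fun x => if x ∈ X' then 1 else 0)
    (by positivity) (abs_pairInd_le_one _) (abs_pairInd_le_one _) (abs_pairInd_le_one _)
    (fun x => by split_ifs <;> simp) (by rwa [abs_of_pos ha0]) (by rwa [abs_of_pos hb0]) hP hR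
  have hu : ∑ x ∈ G.X, (if x ∈ X' then 1 else 0 : ℝ) = X'.card := by
    rw [Finset.sum_boole, Finset.filter_mem_eq_inter, Finset.inter_eq_right.2 hX]
  have hu' : ∀ F : ℕ → ℝ, ∑ x ∈ G.X, (if x ∈ X' then 1 else 0 : ℝ) * F x = ∑ x ∈ X', F x :=
    fun F => by
      simp only [ite_mul, one_mul, zero_mul]
      rw [← Finset.sum_filter, Finset.filter_mem_eq_inter, Finset.inter_eq_right.2 hX]
  rw [hu] at hT
  simp only [hu'] at hT
  set q4 : ℕ → ℕ → ℕ → ℕ → ℝ := fun y₀ y₁ z₀ z₁ =>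
    pairInd Q y₀ z₀ * pairInd Q y₀ z₁ * pairInd Q y₁ z₀ * pairInd Q y₁ z₁ with hq4
  set k4 : ℕ → ℕ → ℕ → ℕ → ℝ := fun y₀ y₁ z₀ z₁ => ∑ x ∈ X',
    pairInd G.EXY x y₀ * pairInd G.EXY x y₁ * pairInd G.EXZ x z₀ * pairInd G.EXZ x z₁ with hk4
  set N := boxSum G.Y G.Z (pairInd Q) with hN
  set T := ∑ y₀ ∈ G.Y, ∑ y₁ ∈ G.Y, ∑ z₀ ∈ G.Z, ∑ z₁ ∈ G.Z, q4 y₀ y₁ z₀ z₁ * k4 y₀ y₁ z₀ z₁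
    with hTdef
  have hidem : ∀ E x y, pairInd E x y * pairInd E x y = pairInd E x y := fun E x y => by
    unfold pairInd
    split_ifs <;> simp
  have hterm : ∀ y₀ y₁ z₀ z₁, c ^ 8 * (q4 y₀ y₁ z₀ z₁ * k4 y₀ y₁ z₀ z₁) ^ 2 ≤
      (∑ x ∈ X', hFun R G x y₀ z₀ * hFun R G x y₀ z₁ * hFun R G x y₁ z₀ * hFun R G x y₁ z₁) ^ 2 :=
    fun y₀ y₁ z₀ z₁ => by
    by_cases hall : (y₀, z₀) ∈ Q ∧ (y₀, z₁) ∈ Q ∧ (y₁, z₀) ∈ Q ∧ (y₁, z₁) ∈ Q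
    · obtain ⟨m1, m2, m3, m4⟩ := hall
      have hq1 : q4 y₀ y₁ z₀ z₁ = 1 := by simp [hq4, pairInd, m1, m2, m3, m4]
      have : ∑ x ∈ X', hFun R G x y₀ z₀ * hFun R G x y₀ z₁ * hFun R G x y₁ z₀ *
          hFun R G x y₁ z₁ = c ^ 4 * k4 y₀ y₁ z₀ z₁ := by
        rw [hk4, Finset.mul_sum]
        refine Finset.sum_congr rfl fun x hx => ?_
        rw [hh x hx _ _ m1, hh x hx _ _ m2, hh x hx _ _ m3, hh x hx _ _ m4]
        calc _ = c ^ 4 * ((pairInd G.EXY x y₀ * pairInd G.EXY x y₀) *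
              (pairInd G.EXY x y₁ * pairInd G.EXY x y₁) *
              (pairInd G.EXZ x z₀ * pairInd G.EXZ x z₀) *
              (pairInd G.EXZ x z₁ * pairInd G.EXZ x z₁)) := by ring
          _ = _ := by simp only [hidem]
      rw [this, hq1]
      exact le_of_eq (by ring)
    · have hq0 : q4 y₀ y₁ z₀ z₁ = 0 := by
        simp only [hq4, pairInd]
        by_contra hne
        simp only [mul_ne_zero_iff, ne_eq, ite_eq_right_iff, one_ne_zero, imp_false, not_not]
          at hne
        exact hall (by tauto)
      rw [hq0]
      simp only [zero_mul, ne_eq, OfNat.ofNat_ne_zero, not_false_eq_true, zero_pow, mul_zero]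
      positivity
  have hCS : c ^ 8 * T ^ 2 ≤ devSum3 R G * N := by
    have h1 : T ^ 2 ≤ (∑ y₀ ∈ G.Y, ∑ y₁ ∈ G.Y, ∑ z₀ ∈ G.Z, ∑ z₁ ∈ G.Z,
        (q4 y₀ y₁ z₀ z₁ * k4 y₀ y₁ z₀ z₁) ^ 2) * N := by
      have := Finset.sum_mul_sq_le_sq_mul_sq (G.Y ×ˢ G.Y ×ˢ G.Z ×ˢ G.Z)
        (fun w => q4 w.1 w.2.1 w.2.2.1 w.2.2.2 * k4 w.1 w.2.1 w.2.2.1 w.2.2.2)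
        (fun w => q4 w.1 w.2.1 w.2.2.1 w.2.2.2)
      have hi : ∀ y₀ y₁ z₀ z₁, q4 y₀ y₁ z₀ z₁ * q4 y₀ y₁ z₀ z₁ = q4 y₀ y₁ z₀ z₁ :=
        fun y₀ y₁ z₀ z₁ => by
        calc _ = (pairInd Q y₀ z₀ * pairInd Q y₀ z₀) * (pairInd Q y₀ z₁ * pairInd Q y₀ z₁) *
              (pairInd Q y₁ z₀ * pairInd Q y₁ z₀) * (pairInd Q y₁ z₁ * pairInd Q y₁ z₁) := by
              simp only [hq4]
              ring
          _ = _ := by simp only [hidem, hq4]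
      have e1 : ∀ w : ℕ × ℕ × ℕ × ℕ, q4 w.1 w.2.1 w.2.2.1 w.2.2.2 *
          k4 w.1 w.2.1 w.2.2.1 w.2.2.2 * q4 w.1 w.2.1 w.2.2.1 w.2.2.2 =
          q4 w.1 w.2.1 w.2.2.1 w.2.2.2 * k4 w.1 w.2.1 w.2.2.1 w.2.2.2 := fun w => by
        rw [mul_right_comm, hi]
      have e2 : ∀ w : ℕ × ℕ × ℕ × ℕ, q4 w.1 w.2.1 w.2.2.1 w.2.2.2 ^ 2 =
          q4 w.1 w.2.1 w.2.2.1 w.2.2.2 := fun w => by rw [sq, hi]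
      simp only [e1, e2] at this
      simp only [Finset.sum_product] at this
      exact this
    calc c ^ 8 * T ^ 2 ≤ c ^ 8 * ((∑ y₀ ∈ G.Y, ∑ y₁ ∈ G.Y, ∑ z₀ ∈ G.Z, ∑ z₁ ∈ G.Z,
        (q4 y₀ y₁ z₀ z₁ * k4 y₀ y₁ z₀ z₁) ^ 2) * N) :=
          mul_le_mul_of_nonneg_left h1 (by positivity)
      _ = (∑ y₀ ∈ G.Y, ∑ y₁ ∈ G.Y, ∑ z₀ ∈ G.Z, ∑ z₁ ∈ G.Z,
        c ^ 8 * (q4 y₀ y₁ z₀ z₁ * k4 y₀ y₁ z₀ z₁) ^ 2) * N := by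
          simp only [← mul_assoc, Finset.mul_sum]
      _ ≤ _ := by
          refine mul_le_mul_of_nonneg_right ?_ (boxSum_nonneg _ _ _)
          refine le_trans ?_ (sum_sq_le_devSum3 R G hX)
          exact Finset.sum_le_sum fun _ _ => Finset.sum_le_sum fun _ _ =>
            Finset.sum_le_sum fun _ _ => Finset.sum_le_sum fun _ _ => hterm _ _ _ _
  have hNlow : (Q.card : ℝ) ^ 4 ≤ (G.Y.card : ℝ) ^ 2 * (G.Z.card : ℝ) ^ 2 * N := by
    have := sum_pow_four_le_boxSum G.Y G.Z (pairInd Q) (fun _ => 1) (fun _ => 1)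
      (by simp) (by simp)
    simpa only [mul_one, sum_pairInd (hQ.trans G.hYZ)] using this
  clear_value N T
  clear hterm hk4 hq4 hTdef hN
  set x := (G.X.card : ℝ)
  set y := (G.Y.card : ℝ)
  set z := (G.Z.card : ℝ)
  set s := (X'.card : ℝ)
  set m := (Q.card : ℝ)
  have hm : δ ^ 2 * (y * z) ≤ m := by
    refine le_trans ?_ hQ'
    rw [hcard, sq, mul_assoc]
    gcongr
  have hNlow' : δ ^ 8 * (y ^ 2 * z ^ 2) ≤ N := by
    have h1 : (δ ^ 2 * (y * z)) ^ 4 ≤ m ^ 4 := by gcongr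
    have h2 : y ^ 2 * z ^ 2 * (δ ^ 8 * (y ^ 2 * z ^ 2)) ≤ y ^ 2 * z ^ 2 * N :=
      le_trans (le_of_eq (by ring)) (h1.trans hNlow)
    exact le_of_mul_le_mul_left h2 (by positivity)
  have hN0 : 0 < N := lt_of_lt_of_le (by positivity) hNlow'
  have hs0 : 0 < s := lt_of_lt_of_le (by positivity) hX'
  have hmain : δ ^ 13 * (x * (y ^ 2 * z ^ 2)) ≤ a ^ 2 * b ^ 2 * s * N := by
    calc δ ^ 13 * (x * (y ^ 2 * z ^ 2))
        = δ ^ 2 * δ ^ 2 * (δ * x) * (δ ^ 8 * (y ^ 2 * z ^ 2)) := by ring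
      _ ≤ _ := by gcongr
  have hTlow : a ^ 2 * b ^ 2 * s * N / 2 ≤ T := by
    have := (abs_le.1 hT).1
    have h3 : 4 * (δ ^ 13 / 8 * x * y ^ 2 * z ^ 2) = δ ^ 13 * (x * (y ^ 2 * z ^ 2)) / 2 := by ring
    linarith
  have hoct' : devSum3 R G ≤ 2 ^ 12 * ε₁ * (a ^ 4 * b ^ 4) * f ^ 4 * (x ^ 2 * y ^ 2 * z ^ 2) := by
    refine hoct.trans ?_
    calc ε₁ * d₁ ^ 4 * d₃ ^ 4 * d₂ ^ 4 * x ^ 2 * y ^ 2 * z ^ 2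
        = ε₁ * d₁ ^ 4 * d₃ ^ 4 * d₂ ^ 4 * (x ^ 2 * y ^ 2 * z ^ 2) := by ring
      _ ≤ ε₁ * (2 * a) ^ 4 * (2 * f) ^ 4 * (2 * b) ^ 4 * (x ^ 2 * y ^ 2 * z ^ 2) := by gcongr
      _ ≤ _ := le_of_eq (by ring)
  have hfin : (a ^ 4 * b ^ 4 * N) * (c ^ 8 * s ^ 2 * N) ≤
      (a ^ 4 * b ^ 4 * N) * (2 ^ 14 * ε₁ * f ^ 4 * (x ^ 2 * y ^ 2 * z ^ 2)) := by
    have h1 : c ^ 8 * (a ^ 2 * b ^ 2 * s * N / 2) ^ 2 ≤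
        (2 ^ 12 * ε₁ * (a ^ 4 * b ^ 4) * f ^ 4 * (x ^ 2 * y ^ 2 * z ^ 2)) * N := by
      refine le_trans ?_ (hCS.trans (mul_le_mul_of_nonneg_right hoct' hN0.le))
      gcongr
    linarith
  have hfin' := le_of_mul_le_mul_left hfin (by positivity)
  calc c ^ 8 * s ^ 2 * m ^ 4 ≤ c ^ 8 * s ^ 2 * (y ^ 2 * z ^ 2 * N) := by gcongr
    _ = y ^ 2 * z ^ 2 * (c ^ 8 * s ^ 2 * N) := by ring
    _ ≤ y ^ 2 * z ^ 2 * (2 ^ 14 * ε₁ * f ^ 4 * (x ^ 2 * y ^ 2 * z ^ 2)) := by gcongr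
    _ = _ := by
        rw [hcard]
        ring

/-- In a quasirandom triad, a relation that only depends on the base pair over many apices is
nearly constant on the base pairs. -/
lemma dev23.exists_majority {R : Finset (ℕ × ℕ × ℕ)} {G : Triad} {X' : Finset ℕ}
    {Q : Finset (ℕ × ℕ)} {φ : ℕ × ℕ → Prop} {δ ν ε₁ ε₂ : ℝ} (hdev : dev23 R G ε₁ ε₂)
    (hX : X' ⊆ G.X) (hQ : Q ⊆ G.EYZ)
    (hφ : ∀ x ∈ X', ∀ p ∈ Q, ((x, p.1, p.2) ∈ R ↔ φ p))
    (hε₁ : 0 ≤ ε₁) (hε₁ν : 2 ^ 22 * ε₁ < ν ^ 6) (hδ : 0 < δ) (hδν : δ ≤ ν) (hν1 : ν ≤ 1)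
    (hε₂ : ε₂ ≤ (δ ^ 13 / 8) ^ 4)
    (hXY : δ ≤ G.bXY.density) (hXZ : δ ≤ G.bXZ.density) (hYZ : δ ≤ G.bYZ.density)
    (hX' : ν * G.X.card ≤ X'.card) :
    ∃ s : Bool, ((Q.filter fun p => ¬ (φ p ↔ s = true)).card : ℝ) < ν * G.EYZ.card := by
  obtain ⟨hx0, -⟩ := Bigraph.card_pos_of_density_pos (hδ.trans_le hXY)
  have he0 : 0 < (G.EYZ.card : ℝ) := by
    have h := Bigraph.card_edges_eq (hδ.trans_le hYZ)
    obtain ⟨hy0, hz0⟩ := Bigraph.card_pos_of_density_pos (hδ.trans_le hYZ)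
    have hp := hδ.trans_le hYZ
    change (G.EYZ.card : ℝ) = _ at h
    rw [h]
    positivity
  change 0 < (G.X.card : ℝ) at hx0
  have hν : 0 < ν := hδ.trans_le hδν
  have hmem : ∀ x ∈ X', ∀ y z, (y, z) ∈ Q →
      ((x, y, z) ∈ G.K3 ↔ (x, y) ∈ G.EXY ∧ (x, z) ∈ G.EXZ) := fun x hx y z hq => by
    have h := hQ hq
    have h' := Finset.mem_product.1 (G.hYZ h)
    simp only [Triad.K3, Finset.mem_filter, Finset.mem_product]
    exact ⟨fun H => ⟨H.2.1, H.2.2.2⟩, fun H => ⟨⟨hX hx, h'⟩, H.1, h, H.2⟩⟩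
  have small : ∀ (c : ℝ) (Q' : Finset (ℕ × ℕ)), 1 / 2 ≤ |c| → Q' ⊆ Q →
      (∀ x ∈ X', ∀ y z, (y, z) ∈ Q' →
        hFun R G x y z = c * (pairInd G.EXY x y * pairInd G.EXZ x z)) →
      (Q'.card : ℝ) < ν * G.EYZ.card := fun c Q' hc hsub hh => by
    by_contra! hlarge
    have h := hdev.card_pow_le hX (hsub.trans hQ) hh hε₁ hδ (hδν.trans hν1) hε₂ hXY hXZ hYZ
      (le_trans (by gcongr) hX') (le_trans (by gcongr) hlarge)
    have hc8 : (1 / 2 : ℝ) ^ 8 ≤ c ^ 8 := by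
      rw [← Even.pow_abs (by decide) c]
      gcongr
    have h2 : (1 / 2 : ℝ) ^ 8 * (ν * G.X.card) ^ 2 * (ν * G.EYZ.card) ^ 4 ≤
        2 ^ 14 * ε₁ * (G.X.card : ℝ) ^ 2 * (G.EYZ.card : ℝ) ^ 4 := by
      refine le_trans ?_ h
      gcongr
    have h3 : ((G.X.card : ℝ) ^ 2 * (G.EYZ.card : ℝ) ^ 4) * ν ^ 6 ≤
        ((G.X.card : ℝ) ^ 2 * (G.EYZ.card : ℝ) ^ 4) * (2 ^ 22 * ε₁) := by linarith
    exact absurd (le_of_mul_le_mul_left h3 (by positivity)) (not_le.2 hε₁ν)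
  by_cases hd : relDensity R G ≤ 1 / 2
  · refine ⟨false, small (1 - relDensity R G) _ ?_ (Finset.filter_subset _ _) ?_⟩
    · rw [abs_of_nonneg] <;> linarith
    · intro x hx y z hq
      rw [Finset.mem_filter] at hq
      have hR : (x, y, z) ∈ R := (hφ x hx _ hq.1).2 (by simpa using hq.2)
      simp only [hFun, hmem x hx y z hq.1, hR, if_true, pairInd]
      split_ifs <;> simp_all
  · refine ⟨true, small (-relDensity R G) _ ?_ (Finset.filter_subset _ _) ?_⟩
    · rw [abs_neg, abs_of_nonneg] <;> linarith
    · intro x hx y z hq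
      rw [Finset.mem_filter] at hq
      have hR : (x, y, z) ∉ R := fun h => hq.2 (by simpa using (hφ x hx _ hq.1).1 h)
      simp only [hFun, hmem x hx y z hq.1, hR, if_false, pairInd]
      split_ifs <;> simp_all

/-- The union of those sets of a family that are small compared with their weights is small. -/
lemma exists_card_le_of_small {ι α : Type*} [Fintype ι] (T : ι → Finset α)
    (w : ι → ℝ) {μ W : ℝ} (hμ : 0 ≤ μ) (hw : ∀ i, 0 ≤ w i) (hW : ∑ i, w i ≤ W) :
    ∃ S : Finset α, (S.card : ℝ) ≤ μ * W ∧
      ∀ i, ∀ x ∈ T i, ((T i).card : ℝ) < μ * w i → x ∈ S := by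
  refine ⟨(Finset.univ.filter fun i => ((T i).card : ℝ) < μ * w i).biUnion T, ?_,
    fun i x hx hi => Finset.mem_biUnion.2 ⟨i, Finset.mem_filter.2 ⟨Finset.mem_univ _, hi⟩, hx⟩⟩
  calc _
      ≤ ((∑ i ∈ Finset.univ.filter fun i => ((T i).card : ℝ) < μ * w i, (T i).card : ℕ) : ℝ) := by
        exact_mod_cast Finset.card_biUnion_le
    _ ≤ ∑ i ∈ Finset.univ.filter fun i => ((T i).card : ℝ) < μ * w i, μ * w i := by
        push_cast
        exact Finset.sum_le_sum fun i hi => (Finset.mem_filter.1 hi).2.le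
    _ ≤ ∑ i, μ * w i := Finset.sum_le_sum_of_subset_of_nonneg (Finset.filter_subset _ _)
        fun i _ _ => mul_nonneg hμ (hw i)
    _ ≤ μ * W := by
        rw [← Finset.mul_sum]
        gcongr

namespace Decomp

lemma regWrt.exists_finset {V : Finset ℕ} {ι κ : Type} {P : Decomp V ι κ}
    {R : Finset (ℕ × ℕ × ℕ)} {ε₁ ε₂ : ℝ} (h : P.regWrt R ε₁ ε₂) :
    ∃ Reg ⊆ V ×ˢ V ×ˢ V, (1 - ε₁) * (V.card : ℝ) ^ 3 ≤ Reg.card ∧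
      ∀ p ∈ Reg, ∃ i j k α β γ,
        p ∈ (P.triadOf i j k α β γ).K3 ∧ dev23 R (P.triadOf i j k α β γ) ε₁ ε₂ :=
  ⟨_, Finset.filter_subset _ _, h, fun _ hp => (Finset.mem_filter.1 hp).2⟩

variable {V : Finset ℕ} {t ℓ : ℕ} (P : Decomp V (Fin t) (Fin ℓ))

lemma sum_card_part : ∑ i, ((P.part i).card : ℝ) ≤ V.card := by
  have h : (Finset.univ.biUnion P.part).card = ∑ i, (P.part i).card :=
    Finset.card_biUnion fun i _ j _ hij => P.part_disj i j hij
  have h' := Finset.card_le_card (Finset.biUnion_subset.2 fun i (_ : i ∈ Finset.univ) =>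
    P.part_sub i)
  rw [h] at h'
  exact_mod_cast h'

lemma sum_card_part_mul :
    ∑ q : Fin t × Fin t, ((P.part q.1).card : ℝ) * (P.part q.2).card ≤ (V.card : ℝ) ^ 2 := by
  rw [Fintype.sum_prod_type]
  dsimp only
  rw [← Finset.sum_mul_sum, ← sq]
  have := P.sum_card_part
  gcongr

lemma sum_card_pairs (i j : Fin t) :
    ∑ α, ((P.pairs i j α).card : ℝ) ≤ (P.part i).card * (P.part j).card := by
  have h : (Finset.univ.biUnion (P.pairs i j)).card = ∑ α, (P.pairs i j α).card :=
    Finset.card_biUnion fun α _ β _ hij => P.pairs_disj i j α β hij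
  have h' := Finset.card_le_card (Finset.biUnion_subset.2 fun α (_ : α ∈ Finset.univ) =>
    P.pairs_sub i j α)
  rw [h, Finset.card_product] at h'
  exact_mod_cast h'

lemma sum_card_pairs_le :
    ∑ q : (Fin t × Fin t) × Fin ℓ, ((P.pairs q.1.1 q.1.2 q.2).card : ℝ) ≤ (V.card : ℝ) ^ 2 := by
  rw [Fintype.sum_prod_type]
  exact (Finset.sum_le_sum fun q _ => P.sum_card_pairs q.1 q.2).trans P.sum_card_part_mul

lemma sum_card_part_mul_div : ∑ q : (Fin t × Fin t) × Fin ℓ,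
    ((P.part q.1.1).card * (P.part q.1.2).card / ℓ : ℝ) ≤ (V.card : ℝ) ^ 2 := by
  rw [Fintype.sum_prod_type]
  refine (Finset.sum_le_sum fun q _ => ?_).trans P.sum_card_part_mul
  dsimp only
  rw [Finset.sum_const, Finset.card_univ, Fintype.card_fin, nsmul_eq_mul]
  rcases eq_or_ne ℓ 0 with rfl | h
  · simp only [Nat.cast_zero, zero_mul]
    positivity
  · rw [mul_div_cancel₀ _ (by exact_mod_cast h)]

lemma part_unique {x : ℕ} {i j : Fin t} (hi : x ∈ P.part i) (hj : x ∈ P.part j) : i = j := by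
  by_contra h
  exact Finset.disjoint_left.1 (P.part_disj i j h) hi hj

lemma pairs_unique {p : ℕ × ℕ} {i j i' j' : Fin t} {α α' : Fin ℓ} (h : p ∈ P.pairs i j α)
    (h' : p ∈ P.pairs i' j' α') : i = i' ∧ j = j' ∧ α = α' := by
  have m := Finset.mem_product.1 (P.pairs_sub _ _ _ h)
  have m' := Finset.mem_product.1 (P.pairs_sub _ _ _ h')
  obtain rfl := P.part_unique m.1 m'.1
  obtain rfl := P.part_unique m.2 m'.2
  refine ⟨rfl, rfl, ?_⟩
  by_contra hne
  exact Finset.disjoint_left.1 (P.pairs_disj i j α α' hne) h h'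

/-- The triple lies in a regular triad of `P` all of whose components are substantial, also
relative to the vertex classes `C`, `A` and `B`. -/
def GoodTriple (R : Finset (ℕ × ℕ × ℕ)) (A B C : Finset ℕ) (ε₁ ε₂ μ s : ℝ) (x y z : ℕ)
    (i j k : Fin t) (α β γ : Fin ℓ) : Prop :=
  (x, y, z) ∈ (P.triadOf i j k α β γ).K3 ∧ dev23 R (P.triadOf i j k α β γ) ε₁ ε₂ ∧
  μ * (P.part i).card ≤ (P.part i ∩ C).card ∧
  μ * ((P.part i).card * (P.part j).card / ℓ : ℝ) ≤ (P.pairs i j α).card ∧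
  μ * ((P.part i).card * (P.part k).card / ℓ : ℝ) ≤ (P.pairs i k β).card ∧
  μ * ((P.part j).card * (P.part k).card / ℓ : ℝ) ≤ (P.pairs j k γ).card ∧
  μ * (P.pairs j k γ).card ≤ (P.pairs j k γ ∩ A ×ˢ B).card ∧
  s ≤ (P.part j ∩ A).card ∧ s ≤ (P.part k ∩ B).card

lemma exists_goodTriple {R : Finset (ℕ × ℕ × ℕ)} {A B C : Finset ℕ} {ε₁ ε₂ μ : ℝ} {n : ℕ}
    (ht : 1 ≤ t) (hV : V.card = 3 * n) (hA : A ⊆ V) (hB : B ⊆ V) (hC : C ⊆ V)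
    (hAn : A.card = n) (hBn : B.card = n) (hCn : C.card ≤ n) (hμ : 0 ≤ μ) (hε₁ : ε₁ ≤ μ)
    (hreg : P.regWrt R ε₁ ε₂) :
    ∃ W : Finset (ℕ × ℕ), (W.card : ℝ) * C.card ≤ 68 * μ * (n : ℝ) ^ 3 ∧
      ∀ y ∈ A, ∀ z ∈ B, (y, z) ∉ W → ∃ x ∈ C, ∃ i j k α β γ,
        P.GoodTriple R A B C ε₁ ε₂ μ (μ * (n / t)) x y z i j k α β γ := by
  have ht' : (0 : ℝ) < t := by exact_mod_cast ht
  have hVr : (V.card : ℝ) = 3 * n := by exact_mod_cast hV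
  have hCr : (C.card : ℝ) ≤ n := by exact_mod_cast hCn
  obtain ⟨N, c0, hN⟩ : ∃ N : Finset (ℕ × ℕ × ℕ), (N.card : ℝ) ≤ 27 * μ * (n : ℝ) ^ 3 ∧
      ∀ x ∈ V, ∀ y ∈ V, ∀ z ∈ V, (x, y, z) ∉ N → ∃ i j k α β γ,
        (x, y, z) ∈ (P.triadOf i j k α β γ).K3 ∧ dev23 R (P.triadOf i j k α β γ) ε₁ ε₂ := by
    obtain ⟨Reg, hsub, hcard, hmem⟩ : ∃ Reg ⊆ V ×ˢ V ×ˢ V,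
        (1 - ε₁) * (V.card : ℝ) ^ 3 ≤ Reg.card ∧ ∀ p ∈ Reg, ∃ i j k α β γ,
          p ∈ (P.triadOf i j k α β γ).K3 ∧ dev23 R (P.triadOf i j k α β γ) ε₁ ε₂ :=
      hreg.exists_finset
    refine ⟨(V ×ˢ V ×ˢ V) \ Reg, ?_, fun x hx y hy z hz h => ?_⟩
    · rw [Finset.cast_card_sdiff hsub, Finset.card_product, Finset.card_product]
      push_cast
      rw [hVr] at hcard ⊢
      have : ε₁ * (n : ℝ) ^ 3 ≤ μ * (n : ℝ) ^ 3 := by gcongr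
      linarith
    · by_contra hne
      exact h (Finset.mem_sdiff.2 ⟨Finset.mem_product.2 ⟨hx, Finset.mem_product.2 ⟨hy, hz⟩⟩,
        fun h' => hne (hmem _ h')⟩)
  obtain ⟨S1, c1, h1⟩ := exists_card_le_of_small (fun i => P.part i ∩ C)
    (fun i => ((P.part i).card : ℝ)) hμ (fun i => by positivity) P.sum_card_part
  obtain ⟨S, c2, h2⟩ := exists_card_le_of_small
    (fun q : (Fin t × Fin t) × Fin ℓ => P.pairs q.1.1 q.1.2 q.2)
    (fun q => ((P.part q.1.1).card * (P.part q.1.2).card / ℓ : ℝ)) hμ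
    (fun i => by positivity) P.sum_card_part_mul_div
  obtain ⟨S5, c5, h5⟩ := exists_card_le_of_small
    (fun q : (Fin t × Fin t) × Fin ℓ => P.pairs q.1.1 q.1.2 q.2 ∩ A ×ˢ B)
    (fun q => ((P.pairs q.1.1 q.1.2 q.2).card : ℝ)) hμ
    (fun i => by positivity) P.sum_card_pairs_le
  have hsum : ∑ _j : Fin t, (n / t : ℝ) ≤ n := by
    rw [Finset.sum_const, Finset.card_univ, Fintype.card_fin, nsmul_eq_mul]
    field_simp
    exact le_rfl
  obtain ⟨S6, c6, h6⟩ := exists_card_le_of_small (fun j => P.part j ∩ A) _ hμ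
    (fun i => by positivity) hsum
  obtain ⟨S7, c7, h7⟩ := exists_card_le_of_small (fun j => P.part j ∩ B) _ hμ
    (fun i => by positivity) hsum
  rw [hVr] at c1 c2 c5
  set W := (A ×ˢ B).filter fun p => ¬ ∃ x ∈ C, ∃ i j k α β γ,
      P.GoodTriple R A B C ε₁ ε₂ μ (μ * (n / t)) x p.1 p.2 i j k α β γ with hW
  have cover : C ×ˢ W ⊆ N ∪ S1 ×ˢ A ×ˢ B ∪
      (S ×ˢ B).image (fun q => (q.1.1, q.1.2, q.2)) ∪
      (S ×ˢ A).image (fun q => (q.1.1, q.2, q.1.2)) ∪ C ×ˢ S ∪ C ×ˢ S5 ∪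
      C ×ˢ S6 ×ˢ B ∪ C ×ˢ A ×ˢ S7 := by
    rintro ⟨x, y, z⟩ hp
    obtain ⟨hx, hyz⟩ := Finset.mem_product.1 hp
    obtain ⟨hyz, hbad⟩ := Finset.mem_filter.1 hyz
    obtain ⟨hy, hz⟩ := Finset.mem_product.1 hyz
    change x ∈ C at hx
    change y ∈ A at hy
    change z ∈ B at hz
    by_contra hnot
    simp only [Finset.mem_union, not_or] at hnot
    obtain ⟨⟨⟨⟨⟨⟨⟨n0, n1⟩, n2⟩, n3⟩, n4⟩, n5⟩, n6⟩, n7⟩ := hnot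
    obtain ⟨i, j, k, α, β, γ, hK, hdev⟩ := hN x (hC hx) y (hA hy) z (hB hz) n0
    refine hbad ⟨x, hx, i, j, k, α, β, γ, hK, hdev, ?_⟩
    have hK' := Finset.mem_filter.1 hK
    obtain ⟨hxi, hyj, hzk⟩ : x ∈ P.part i ∧ y ∈ P.part j ∧ z ∈ P.part k := by
      simpa [triadOf] using hK'.1
    obtain ⟨hxy, hyz', hxz⟩ : (x, y) ∈ P.pairs i j α ∧ (y, z) ∈ P.pairs j k γ ∧
      (x, z) ∈ P.pairs i k β := hK'.2
    refine ⟨?_, ?_, ?_, ?_, ?_, ?_, ?_⟩ <;> by_contra! hlt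
    · exact n1 (Finset.mem_product.2 ⟨h1 i x (Finset.mem_inter.2 ⟨hxi, hx⟩) hlt,
        Finset.mem_product.2 ⟨hy, hz⟩⟩)
    · exact n2 (Finset.mem_image.2 ⟨((x, y), z),
        Finset.mem_product.2 ⟨h2 ((i, j), α) _ hxy hlt, hz⟩, rfl⟩)
    · exact n3 (Finset.mem_image.2 ⟨((x, z), y),
        Finset.mem_product.2 ⟨h2 ((i, k), β) _ hxz hlt, hy⟩, rfl⟩)
    · exact n4 (Finset.mem_product.2 ⟨hx, h2 ((j, k), γ) _ hyz' hlt⟩)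
    · exact n5 (Finset.mem_product.2 ⟨hx,
        h5 ((j, k), γ) _ (Finset.mem_inter.2 ⟨hyz', hyz⟩) hlt⟩)
    · exact n6 (Finset.mem_product.2 ⟨hx,
        Finset.mem_product.2 ⟨h6 j y (Finset.mem_inter.2 ⟨hyj, hy⟩) hlt, hz⟩⟩)
    · exact n7 (Finset.mem_product.2 ⟨hx,
        Finset.mem_product.2 ⟨hy, h7 k z (Finset.mem_inter.2 ⟨hzk, hz⟩) hlt⟩⟩)
  refine ⟨W, ?_, fun y hy z hz h => ?_⟩
  swap
  · by_contra hne
    exact h (Finset.mem_filter.2 ⟨Finset.mem_product.2 ⟨hy, hz⟩, hne⟩)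
  have hcard : (C.card * W.card : ℝ) ≤ N.card + S1.card * (n * n) +
      S.card * n + S.card * n + C.card * S.card + C.card * S5.card + C.card * (S6.card * n) +
      C.card * (n * S7.card) := by
    have h := Finset.card_le_card cover
    have h' : C.card * W.card ≤ N.card + S1.card * (n * n) +
        S.card * n + S.card * n + C.card * S.card + C.card * S5.card + C.card * (S6.card * n) +
        C.card * (n * S7.card) := by
      rw [← Finset.card_product]
      refine h.trans ?_
      refine (Finset.card_union_le _ _).trans (add_le_add ?_ (by simp [hAn]))
      refine (Finset.card_union_le _ _).trans (add_le_add ?_ (by simp [hBn]))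
      refine (Finset.card_union_le _ _).trans (add_le_add ?_ (by simp))
      refine (Finset.card_union_le _ _).trans (add_le_add ?_ (by simp))
      refine (Finset.card_union_le _ _).trans (add_le_add ?_
        (Finset.card_image_le.trans (by simp [hAn])))
      refine (Finset.card_union_le _ _).trans (add_le_add ?_
        (Finset.card_image_le.trans (by simp [hBn])))
      exact (Finset.card_union_le _ _).trans (add_le_add le_rfl (by simp [hAn, hBn]))
    exact_mod_cast h'
  calc (W.card : ℝ) * C.card = C.card * W.card := mul_comm _ _
    _ ≤ _ := hcard
    _ ≤ 27 * μ * (n : ℝ) ^ 3 + μ * (3 * n) * (n * n) + μ * (3 * n) ^ 2 * n +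
        μ * (3 * n) ^ 2 * n + n * (μ * (3 * n) ^ 2) + n * (μ * (3 * n) ^ 2) + n * (μ * n * n) +
        n * (n * (μ * n)) := by gcongr
    _ = 68 * μ * (n : ℝ) ^ 3 := by ring

end Decomp

lemma BipColored.exists_color {U : Finset ℕ} (Γ : BipColored U) :
    ∃ c : ℕ × ℕ → ℕ, ∀ p ∈ Γ.A ×ˢ Γ.B, c p ∈ U ∧ ({p.1, p.2} : Finset ℕ) ∈ Γ.P (c p) := by
  have h : ∀ p : ℕ × ℕ, ∃ u, p ∈ Γ.A ×ˢ Γ.B → u ∈ U ∧ ({p.1, p.2} : Finset ℕ) ∈ Γ.P u := by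
    intro p
    by_cases hp : p ∈ Γ.A ×ˢ Γ.B
    · have : ({p.1, p.2} : Finset ℕ) ∈ U.biUnion Γ.P := by
        rw [Γ.P_cover]
        exact Finset.mem_image_of_mem (fun p : ℕ × ℕ => ({p.1, p.2} : Finset ℕ)) hp
      obtain ⟨u, hu⟩ := Finset.mem_biUnion.1 this
      exact ⟨u, fun _ => hu⟩
    · exact ⟨0, fun h => absurd h hp⟩
  choose c hc using h
  exact ⟨c, hc⟩

namespace IsBlowupWith

variable {G : Bigraph} {m : ℕ} {Γ : BipColored G.left} {Cfam : ℕ → Finset ℕ} {H : ThreeGraph}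

lemma left_subset (h : IsBlowupWith G m Γ Cfam H) : Γ.A ⊆ H.verts := by
  rw [h.2.2.2.1]
  exact Finset.subset_union_left.trans Finset.subset_union_left

lemma right_subset (h : IsBlowupWith G m Γ Cfam H) : Γ.B ⊆ H.verts := by
  rw [h.2.2.2.1]
  exact Finset.subset_union_right.trans Finset.subset_union_left

lemma class_subset (h : IsBlowupWith G m Γ Cfam H) {v : ℕ} (hv : v ∈ G.right) :
    Cfam v ⊆ H.verts := by
  rw [h.2.2.2.1]
  exact (Finset.subset_biUnion_of_mem Cfam hv).trans Finset.subset_union_right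

lemma card_verts (h : IsBlowupWith G m Γ Cfam H) :
    H.verts.card = Γ.A.card + Γ.B.card + G.right.card * m := by
  obtain ⟨h1, h2, h3, h4, -⟩ := h
  rw [h4, Finset.card_union_of_disjoint, Finset.card_union_of_disjoint Γ.disjAB,
    Finset.card_biUnion h2, Finset.sum_congr rfl h1, Finset.sum_const, smul_eq_mul]
  exact ((Finset.disjoint_biUnion_left _ _ _).2 h3).symm

lemma mem_obar_iff (h : IsBlowupWith G m Γ Cfam H) {u v x y z : ℕ} (hu : u ∈ G.left)
    (hv : v ∈ G.right) (hx : x ∈ Cfam v) (hy : y ∈ Γ.A) (hz : z ∈ Γ.B)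
    (hp : ({y, z} : Finset ℕ) ∈ Γ.P u) : (x, y, z) ∈ H.obar ↔ (u, v) ∈ G.edges := by
  obtain ⟨h1, h2⟩ := h.2.2.2.2 u hu v hv _ hp x hx
  refine ⟨fun h' => ?_, fun h' => ?_⟩
  · by_contra hne
    exact h2 hne (Finset.mem_filter.1 h').2
  · exact Finset.mem_filter.2 ⟨Finset.mem_product.2 ⟨h.class_subset hv hx,
      Finset.mem_product.2 ⟨h.left_subset hy, h.right_subset hz⟩⟩, h1 h'⟩

end IsBlowupWith

lemma encodeSet_injective : Function.Injective encodeSet := Finset.geomSum_injective le_rfl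

lemma mem_edges_Ubg {k i : ℕ} {S : Finset ℕ} (hS : S ⊆ Finset.range k) :
    (encodeSet S, i) ∈ (Ubg k).edges ↔ i ∈ S := by
  simp only [Ubg, Finset.mem_biUnion, Finset.mem_image, Finset.mem_powerset, Prod.mk.injEq]
  constructor
  · rintro ⟨T, -, j, hj, hT, rfl⟩
    rwa [← encodeSet_injective hT]
  · exact fun hi => ⟨S, hS, i, hi, rfl, rfl⟩

lemma Ubg_left_ext {k u u' : ℕ} (hu : u ∈ (Ubg k).left) (hu' : u' ∈ (Ubg k).left)
    (h : ∀ v ∈ Finset.range k, (u, v) ∈ (Ubg k).edges ↔ (u', v) ∈ (Ubg k).edges) : u = u' := by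
  obtain ⟨S, hS, rfl⟩ := Finset.mem_image.1 hu
  obtain ⟨T, hT, rfl⟩ := Finset.mem_image.1 hu'
  rw [Finset.mem_powerset] at hS hT
  congr 1
  ext i
  refine ⟨fun hi => ?_, fun hi => ?_⟩
  · have := (h i (hS hi)).1 ((mem_edges_Ubg hS).2 hi)
    exact (mem_edges_Ubg hT).1 this
  · have := (h i (hT hi)).2 ((mem_edges_Ubg hT).2 hi)
    exact (mem_edges_Ubg hS).1 this

/-- Removing `K` sets, each of relative size less than `1/(2K)`, leaves at least half of `Q`. -/
lemma exists_subset_card_le_two_mul {α : Type*} {Q : Finset α} {K : ℕ} (T : ℕ → Finset α)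
    (h : ∀ v ∈ Finset.range K, ((T v).card : ℝ) * (2 * K) < Q.card) :
    ∃ D ⊆ Q, (Q.card : ℝ) ≤ 2 * D.card ∧ ∀ v ∈ Finset.range K, ∀ p ∈ D, p ∉ T v := by
  refine ⟨Q \ (Finset.range K).biUnion T, Finset.sdiff_subset, ?_, fun v hv p hp hpv =>
    (Finset.mem_sdiff.1 hp).2 (Finset.mem_biUnion.2 ⟨v, hv, hpv⟩)⟩
  have h1 : (Q.card : ℝ) ≤ ((Finset.range K).biUnion T).card +
      (Q \ (Finset.range K).biUnion T).card := by
    have := Finset.card_le_card_sdiff_add_card (s := Q) (t := (Finset.range K).biUnion T)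
    rw [add_comm] at this
    exact_mod_cast this
  have h2 : (((Finset.range K).biUnion T).card : ℝ) * 2 ≤ Q.card := by
    rcases Nat.eq_zero_or_pos K with rfl | hK
    · simp
    have hK' : (0 : ℝ) < K := by exact_mod_cast hK
    calc _ ≤ (∑ v ∈ Finset.range K, ((T v).card : ℝ)) * 2 := by
          gcongr
          exact_mod_cast Finset.card_biUnion_le
      _ ≤ ∑ _v ∈ Finset.range K, (Q.card : ℝ) / K := by
          rw [Finset.sum_mul]
          refine Finset.sum_le_sum fun v hv => ?_
          rw [le_div_iff₀ hK', mul_assoc]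
          exact (h v hv).le
      _ = Q.card := by
          rw [Finset.sum_const, Finset.card_range, nsmul_eq_mul]
          field_simp
  linarith

lemma Bigraph.EpsRegular.card_inter_le {B : Bigraph} {ε d : ℝ} (h : B.EpsRegular ε)
    (hd : |B.density - d| ≤ ε) {X Y : Finset ℕ} (hX : X ⊆ B.left) (hY : Y ⊆ B.right)
    (hXc : ε * B.left.card ≤ X.card) (hYc : ε * B.right.card ≤ Y.card) :
    ((B.edges ∩ X ×ˢ Y).card : ℝ) ≤ (d + 2 * ε) * (X.card * Y.card) := by
  have h1 := (abs_le.1 (h X hX Y hY hXc hYc)).1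
  have h2 := (abs_le.1 hd).2
  have h3 : B.dBetween X Y ≤ d + 2 * ε := by linarith
  rcases Finset.eq_empty_or_nonempty (X ×ˢ Y) with h0 | h0
  · have : (X.card * Y.card : ℝ) = 0 := by
      rw [← Nat.cast_mul, ← Finset.card_product, h0]
      simp
    rw [this, h0]
    simp
  · have hpos : (0 : ℝ) < X.card * Y.card := by
      rw [← Nat.cast_mul, ← Finset.card_product]
      exact_mod_cast h0.card_pos
    rwa [Bigraph.dBetween, div_le_iff₀ hpos] at h3

lemma Bigraph.le_density {B : Bigraph} {c : ℝ} (hl : B.left.Nonempty) (hr : B.right.Nonempty)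
    (h : c * (B.left.card * B.right.card) ≤ B.edges.card) : c ≤ B.density := by
  have hpos : (0 : ℝ) < B.left.card * B.right.card := by
    have := hl.card_pos
    have := hr.card_pos
    positivity
  rwa [Bigraph.density, le_div_iff₀ hpos]

/-- Some pair of `A × B` lies, for every class of the blowup, in a good triple of `P`. -/
lemma exists_pair_goodTriple {K n t ℓ : ℕ} {Γ : BipColored (Ubg K).left} {Cfam : ℕ → Finset ℕ}
    {H : ThreeGraph} (hH : IsBlowupWith (Ubg K) (n / K) Γ Cfam H)
    (P : Decomp H.verts (Fin t) (Fin ℓ)) {R : Finset (ℕ × ℕ × ℕ)} {ε₁ ε₂ μ : ℝ}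
    (hKn : K ∣ n) (hn : 1 ≤ n) (ht : 1 ≤ t) (hA : Γ.A.card = n) (hB : Γ.B.card = n)
    (hμ : 0 ≤ μ) (hμK : 68 * μ * (K : ℝ) ^ 2 < 1) (hε₁ : ε₁ ≤ μ) (hP : P.regWrt R ε₁ ε₂) :
    ∃ y ∈ Γ.A, ∃ z ∈ Γ.B, ∀ v ∈ Finset.range K, ∃ x ∈ Cfam v, ∃ i j k α β γ,
      P.GoodTriple R Γ.A Γ.B (Cfam v) ε₁ ε₂ μ (μ * (n / t)) x y z i j k α β γ := by
  have hn' : (0 : ℝ) < n := by exact_mod_cast hn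
  have hK : 0 < K := Nat.pos_of_dvd_of_pos hKn hn
  have hK' : (0 : ℝ) < K := by exact_mod_cast hK
  have hcard : H.verts.card = 3 * n := by
    rw [hH.card_verts, hA, hB, Ubg, Finset.card_range, Nat.mul_div_cancel' hKn]
    ring
  have hex : ∀ v, ∃ W : Finset (ℕ × ℕ), v ∈ Finset.range K →
      (W.card : ℝ) ≤ 68 * μ * K * (n : ℝ) ^ 2 ∧
      ∀ y ∈ Γ.A, ∀ z ∈ Γ.B, (y, z) ∉ W → ∃ x ∈ Cfam v, ∃ i j k α β γ,
        P.GoodTriple R Γ.A Γ.B (Cfam v) ε₁ ε₂ μ (μ * (n / t)) x y z i j k α β γ := by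
    intro v
    by_cases hv : v ∈ Finset.range K
    · have hCv : (Cfam v).card = n / K := hH.1 v hv
      obtain ⟨W, hW, hW'⟩ := P.exists_goodTriple ht hcard hH.left_subset hH.right_subset
        (hH.class_subset hv) hA hB (hCv.trans_le (Nat.div_le_self _ _)) hμ hε₁ hP
      refine ⟨W, fun _ => ⟨?_, hW'⟩⟩
      rw [hCv, Nat.cast_div hKn hK'.ne', mul_div_assoc', div_le_iff₀ hK'] at hW
      refine le_of_mul_le_mul_right (hW.trans_eq ?_) hn'
      ring
    · exact ⟨∅, fun h => absurd h hv⟩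
  choose W hW using hex
  by_contra! hne
  have hsub : Γ.A ×ˢ Γ.B ⊆ (Finset.range K).biUnion W := by
    rintro ⟨y, z⟩ hp
    obtain ⟨hy, hz⟩ := Finset.mem_product.1 hp
    obtain ⟨v, hv, hbad⟩ := hne y hy z hz
    refine Finset.mem_biUnion.2 ⟨v, hv, ?_⟩
    by_contra hyz
    obtain ⟨x, hx, i, j, k, α, β, γ, hg⟩ := (hW v hv).2 y hy z hz hyz
    exact hbad x hx i j k α β γ hg
  have hle : (n : ℝ) ^ 2 ≤ ∑ v ∈ Finset.range K, ((W v).card : ℝ) := by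
    have := (Finset.card_le_card hsub).trans Finset.card_biUnion_le
    rw [Finset.card_product, hA, hB, ← sq] at this
    exact_mod_cast this
  have hle' : (n : ℝ) ^ 2 ≤ (68 * μ * (K : ℝ) ^ 2) * (n : ℝ) ^ 2 := by
    refine hle.trans ((Finset.sum_le_sum fun v hv => (hW v hv).1).trans_eq ?_)
    rw [Finset.sum_const, Finset.card_range, nsmul_eq_mul]
    ring
  have : (0 : ℝ) < (n : ℝ) ^ 2 := by positivity
  nlinarith

/-- On a good triple through a class `C` on which membership in `R` only depends on the pair in
`A × B`, one of the two outcomes is rare. -/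
lemma Decomp.GoodTriple.exists_minority {V : Finset ℕ} {t ℓ : ℕ} {P : Decomp V (Fin t) (Fin ℓ)}
    {R : Finset (ℕ × ℕ × ℕ)} {A B C : Finset ℕ} {ε₁ ε₂ μ ν s : ℝ} {x y z : ℕ} {i j k : Fin t}
    {α β γ : Fin ℓ} (hg : P.GoodTriple R A B C ε₁ ε₂ μ s x y z i j k α β γ)
    {φ : ℕ × ℕ → Prop}
    (hφ : ∀ x ∈ C, ∀ p ∈ A ×ˢ B, ((x, p.1, p.2) ∈ R ↔ φ p)) (hε₁ : 0 ≤ ε₁)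
    (hε₁ν : 2 ^ 22 * ε₁ < ν ^ 6) (hν : 0 < ν) (hνμ : ν ≤ μ) (hμ1 : μ ≤ 1)
    (hε₂ : ε₂ ≤ ((ν / (ℓ + 1)) ^ 13 / 8) ^ 4) :
    ∃ b : Bool, ∃ T : Finset (ℕ × ℕ), (T.card : ℝ) < ν * (P.pairs j k γ).card ∧
      ∀ p ∈ P.pairs j k γ ∩ A ×ˢ B, p ∉ T → (φ p ↔ b = true) := by
  obtain ⟨hK, hdev, h1, h2, h3, h4, h5, -, -⟩ := hg
  have hK' := (Finset.mem_filter.1 hK).1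
  have hx : x ∈ P.part i := (Finset.mem_product.1 hK').1
  have hy : y ∈ P.part j := (Finset.mem_product.1 (Finset.mem_product.1 hK').2).1
  have hz : z ∈ P.part k := (Finset.mem_product.1 (Finset.mem_product.1 hK').2).2
  have hℓ : (0 : ℝ) < ℓ := by exact_mod_cast Fin.pos α
  have hδ : 0 < ν / (ℓ + 1) := by positivity
  have hassoc : ∀ a b : ℝ, μ / ℓ * (a * b) = μ * (a * b / ℓ) := fun a b => by ring
  have hδμ : ν / (ℓ + 1) ≤ μ / ℓ := by gcongr <;> linarith
  have hXY : μ / ℓ ≤ (P.triadOf i j k α β γ).bXY.density :=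
    Bigraph.le_density ⟨x, hx⟩ ⟨y, hy⟩ ((hassoc _ _).trans_le h2)
  have hXZ : μ / ℓ ≤ (P.triadOf i j k α β γ).bXZ.density :=
    Bigraph.le_density ⟨x, hx⟩ ⟨z, hz⟩ ((hassoc _ _).trans_le h3)
  have hYZ : μ / ℓ ≤ (P.triadOf i j k α β γ).bYZ.density :=
    Bigraph.le_density ⟨y, hy⟩ ⟨z, hz⟩ ((hassoc _ _).trans_le h4)
  have hX' : ν * (P.part i).card ≤ (P.part i ∩ C).card :=
    (mul_le_mul_of_nonneg_right hνμ (Nat.cast_nonneg _)).trans h1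
  obtain ⟨b, hb⟩ := hdev.exists_majority (X' := P.part i ∩ C) Finset.inter_subset_left
    Finset.inter_subset_left (fun x hx p hp => hφ x (Finset.mem_inter.1 hx).2 p
      (Finset.mem_inter.1 hp).2) hε₁ hε₁ν hδ (div_le_self hν.le (by linarith))
    (hνμ.trans hμ1) hε₂ (hδμ.trans hXY) (hδμ.trans hXZ) (hδμ.trans hYZ) hX'
  exact ⟨b, _, hb, fun p hp hpT => by_contra fun h => hpT (Finset.mem_filter.2 ⟨hp, h⟩)⟩

/-- A regular decomposition of a blowup of `U_bg(K)` has a pair class with a large part in a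
single color of `Γ`. -/
lemma exists_monochromatic {K n t ℓ : ℕ} {Γ : BipColored (Ubg K).left} {Cfam : ℕ → Finset ℕ}
    {H : ThreeGraph} (hH : IsBlowupWith (Ubg K) (n / K) Γ Cfam H)
    (P : Decomp H.verts (Fin t) (Fin ℓ)) {ε₁ ε₂ μ : ℝ} (hKn : K ∣ n) (hn : 1 ≤ n) (ht : 1 ≤ t)
    (hA : Γ.A.card = n) (hB : Γ.B.card = n) (hμ : 0 < μ) (hμ1 : μ ≤ 1)
    (hμK : 68 * μ * (K : ℝ) ^ 2 < 1) (hε₁0 : 0 ≤ ε₁) (hε₁ : ε₁ ≤ μ)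
    (hε₁K : 2 ^ 22 * ε₁ < (μ / (2 * K)) ^ 6)
    (hε₂ : ε₂ ≤ ((μ / (2 * K) / (ℓ + 1)) ^ 13 / 8) ^ 4) (hP : P.regWrt H.obar ε₁ ε₂) :
    ∃ u ∈ (Ubg K).left, ∃ j k γ, (P.part j).Nonempty ∧ (P.part k).Nonempty ∧
      μ * (n / t) ≤ (P.part j ∩ Γ.A).card ∧ μ * (n / t) ≤ (P.part k ∩ Γ.B).card ∧
      μ * ((P.part j).card * (P.part k).card / ℓ : ℝ) ≤ (P.pairs j k γ).card ∧
      μ * (P.pairs j k γ).card ≤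
        2 * ((Γ.colorBG u).edges ∩ (P.part j ∩ Γ.A) ×ˢ (P.part k ∩ Γ.B)).card := by
  have hK : 1 ≤ K := Nat.pos_of_dvd_of_pos hKn hn
  have hK' : (1 : ℝ) ≤ K := by exact_mod_cast hK
  obtain ⟨y, hy, z, hz, hyz⟩ :=
    exists_pair_goodTriple hH P hKn hn ht hA hB hμ.le hμK hε₁ hP
  obtain ⟨c, hc⟩ := Γ.exists_color
  obtain ⟨x₀, -, i₀, j, k, α₀, β₀, γ, hg₀⟩ := hyz 0 (Finset.mem_range.2 hK)
  have hmem : ∀ {x i j k α β γ} {C : Finset ℕ} {s : ℝ},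
      P.GoodTriple H.obar Γ.A Γ.B C ε₁ ε₂ μ s x y z i j k α β γ → (y, z) ∈ P.pairs j k γ :=
    fun hg => (Finset.mem_filter.1 hg.1).2.2.1
  obtain ⟨hyj, hzk⟩ := Finset.mem_product.1 (P.pairs_sub _ _ _ (hmem hg₀))
  obtain ⟨Q, hQ⟩ : ∃ Q, Q = P.pairs j k γ ∩ Γ.A ×ˢ Γ.B := ⟨_, rfl⟩
  have hQpos : (0 : ℝ) < Q.card := by
    have : (y, z) ∈ Q := hQ ▸ Finset.mem_inter.2 ⟨hmem hg₀, Finset.mem_product.2 ⟨hy, hz⟩⟩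
    exact_mod_cast Finset.card_pos.2 ⟨_, this⟩
  have hbit : ∀ v, ∃ b : Bool, ∃ T : Finset (ℕ × ℕ), v ∈ Finset.range K →
      (T.card : ℝ) * (2 * K) < Q.card ∧
      ∀ p ∈ Q, p ∉ T → ((c p, v) ∈ (Ubg K).edges ↔ b = true) := by
    intro v
    by_cases hv : v ∈ Finset.range K
    · obtain ⟨x, hx, i, j', k', α, β, γ', hg⟩ := hyz v hv
      obtain ⟨rfl, rfl, rfl⟩ := P.pairs_unique (hmem hg₀) (hmem hg)
      have hφ : ∀ x ∈ Cfam v, ∀ p ∈ Γ.A ×ˢ Γ.B,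
          ((x, p.1, p.2) ∈ H.obar ↔ (c p, v) ∈ (Ubg K).edges) := fun x hx p hp =>
        hH.mem_obar_iff (hc p hp).1 hv hx (Finset.mem_product.1 hp).1 (Finset.mem_product.1 hp).2
          (hc p hp).2
      obtain ⟨b, T, hT, hb⟩ := hg.exists_minority (φ := fun p => (c p, v) ∈ (Ubg K).edges)
        (ν := μ / (2 * K)) hφ hε₁0 hε₁K (by positivity)
        (div_le_self hμ.le (by linarith)) hμ1 hε₂
      refine ⟨b, T, fun _ => ⟨lt_of_lt_of_le ?_ (hQ ▸ hg.2.2.2.2.2.2.1), hQ ▸ hb⟩⟩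
      rwa [div_mul_eq_mul_div, lt_div_iff₀ (by positivity)] at hT
    · exact ⟨true, ∅, fun h => absurd h hv⟩
  choose b T hb using hbit
  obtain ⟨D, hDsubQ, hD, hDT⟩ := exists_subset_card_le_two_mul T fun v hv => (hb v hv).1
  have hDb : ∀ p ∈ D, ∀ v ∈ Finset.range K, ((c p, v) ∈ (Ubg K).edges ↔ b v = true) :=
    fun p hp v hv => (hb v hv).2 p (hDsubQ hp) (hDT v hv p hp)
  obtain ⟨p₀, hp₀⟩ : D.Nonempty := by
    rw [← Finset.card_pos]
    have : (0 : ℝ) < D.card := by linarith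
    exact_mod_cast this
  have hDQ : ∀ p ∈ D, p ∈ P.pairs j k γ ∧ p ∈ Γ.A ×ˢ Γ.B := fun p hp =>
    Finset.mem_inter.1 (hQ ▸ hDsubQ hp)
  have hcol : ∀ p ∈ D, c p = c p₀ := fun p hp =>
    Ubg_left_ext (hc p (hDQ p hp).2).1 (hc p₀ (hDQ p₀ hp₀).2).1 fun v hv =>
      (hDb p hp v hv).trans (hDb p₀ hp₀ v hv).symm
  have hDsub : D ⊆ (Γ.colorBG (c p₀)).edges ∩ (P.part j ∩ Γ.A) ×ˢ (P.part k ∩ Γ.B) := by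
    intro p hp
    obtain ⟨h1, h2⟩ := hDQ p hp
    have h3 := Finset.mem_product.1 (P.pairs_sub _ _ _ h1)
    have h4 := Finset.mem_product.1 h2
    refine Finset.mem_inter.2 ⟨Finset.mem_filter.2 ⟨h2, ?_⟩, Finset.mem_product.2
      ⟨Finset.mem_inter.2 ⟨h3.1, h4.1⟩, Finset.mem_inter.2 ⟨h3.2, h4.2⟩⟩⟩
    rw [← hcol p hp]
    exact (hc p h2).2
  obtain ⟨-, -, -, -, -, h4, h5, h6, h7⟩ := hg₀
  refine ⟨c p₀, (hc p₀ (hDQ p₀ hp₀).2).1, j, k, γ, ⟨y, hyj⟩, ⟨z, hzk⟩, h6, h7, h4,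
    h5.trans (hQ ▸ hD.trans ?_)⟩
  exact_mod_cast Nat.mul_le_mul_left 2 (Finset.card_le_card hDsub)

theorem le_of_regWrt_blowup {K n t ℓ : ℕ} {Γ : BipColored (Ubg K).left} {H : ThreeGraph}
    (hH : IsBlowup (Ubg K) (n / K) Γ H) (P : Decomp H.verts (Fin t) (Fin ℓ))
    {ε ε₁ ε₂ μ : ℝ} (hKn : K ∣ n) (hn : 1 ≤ n) (ht : 1 ≤ t) (hA : Γ.A.card = n)
    (hB : Γ.B.card = n)
    (hΓ : ∀ u ∈ (Ubg K).left, (Γ.colorBG u).EpsRegular ε ∧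
      |(Γ.colorBG u).density - ((2 : ℝ) ^ K)⁻¹| ≤ ε)
    (hε : ε ≤ μ / t) (hε' : ε ≤ ((2 : ℝ) ^ K)⁻¹) (hμ : 0 < μ) (hμ1 : μ ≤ 1)
    (hμK : 68 * μ * (K : ℝ) ^ 2 < 1) (hε₁0 : 0 ≤ ε₁) (hε₁ : ε₁ ≤ μ)
    (hε₁K : 2 ^ 22 * ε₁ < (μ / (2 * K)) ^ 6)
    (hε₂ : ε₂ ≤ ((μ / (2 * K) / (ℓ + 1)) ^ 13 / 8) ^ 4) (hP : P.regWrt H.obar ε₁ ε₂) :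
    μ ^ 2 * 2 ^ K ≤ 6 * ℓ := by
  obtain ⟨Cfam, hH⟩ := hH
  obtain ⟨u, hu, j, k, γ, hj, hk, h6, h7, h4, h5⟩ :=
    exists_monochromatic hH P hKn hn ht hA hB hμ hμ1 hμK hε₁0 hε₁ hε₁K hε₂ hP
  have ht' : (0 : ℝ) < t := by exact_mod_cast ht
  obtain ⟨hreg, hden⟩ := hΓ u hu
  have hεn : ε * n ≤ μ * (n / t) := by
    calc ε * n ≤ μ / t * n := by gcongr
      _ = μ * (n / t) := by ring
  have hupper := hreg.card_inter_le hden (X := P.part j ∩ Γ.A) (Y := P.part k ∩ Γ.B)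
    Finset.inter_subset_right Finset.inter_subset_right
    (by rw [BipColored.colorBG, hA]; exact hεn.trans h6)
    (by rw [BipColored.colorBG, hB]; exact hεn.trans h7)
  have hℓ : (0 : ℝ) < ℓ := by exact_mod_cast Fin.pos γ
  have hm : (0 : ℝ) < (P.part j).card * (P.part k).card := by
    have := hj.card_pos
    have := hk.card_pos
    positivity
  have hchain : μ * (μ * ((P.part j).card * (P.part k).card / ℓ)) ≤
      2 * (3 * ((2 : ℝ) ^ K)⁻¹ * ((P.part j).card * (P.part k).card)) := by
    calc μ * (μ * ((P.part j).card * (P.part k).card / ℓ : ℝ))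
        ≤ μ * (P.pairs j k γ).card := by gcongr
      _ ≤ _ := h5
      _ ≤ 2 * (((2 : ℝ) ^ K)⁻¹ + 2 * ε) *
            ((P.part j ∩ Γ.A).card * (P.part k ∩ Γ.B).card) := by
        rw [mul_assoc]
        exact mul_le_mul_of_nonneg_left hupper zero_le_two
      _ ≤ 2 * (3 * ((2 : ℝ) ^ K)⁻¹) * ((P.part j).card * (P.part k).card) := by
        gcongr
        · linarith
        · exact Finset.inter_subset_left
        · exact Finset.inter_subset_left
      _ = _ := by ring
  have hchain' : μ ^ 2 / ℓ ≤ 6 * ((2 : ℝ) ^ K)⁻¹ := by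
    refine le_of_mul_le_mul_right (le_trans (le_of_eq ?_) (hchain.trans (le_of_eq ?_))) hm <;> ring
  rw [div_le_iff₀ hℓ] at hchain'
  calc μ ^ 2 * 2 ^ K ≤ 6 * ((2 : ℝ) ^ K)⁻¹ * ℓ * 2 ^ K := by gcongr
    _ = 6 * ℓ := by field_simp

lemma mul_pow_le_two_pow {k : ℕ} (hk : 1000 ≤ k) : 36 * k ^ 12 ≤ 2 ^ k := by
  induction k, hk using Nat.le_induction with
  | base =>
    calc 36 * 1000 ^ 12 ≤ 2 ^ 200 := by norm_num
      _ ≤ _ := Nat.pow_le_pow_right two_pos (by norm_num)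
  | succ k hk ih =>
    have h1 : (1000 * (k + 1)) ^ 12 ≤ (1001 * k) ^ 12 := Nat.pow_le_pow_left (by omega) 12
    rw [mul_pow, mul_pow] at h1
    have h2 : (k + 1) ^ 12 ≤ 2 * k ^ 12 := by
      refine Nat.le_of_mul_le_mul_left (h1.trans ?_) (by norm_num : 0 < 1000 ^ 12)
      rw [← mul_assoc]
      exact Nat.mul_le_mul_right _ (by norm_num)
    rw [pow_succ 2 k]
    omega

lemma six_mul_pow_le_two_rpow {k : ℕ} (hk : 1000 ≤ k) :
    6 * (k : ℝ) ^ 6 ≤ (2 : ℝ) ^ ((k : ℝ) / 2) := by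
  have h : (36 : ℝ) * (k : ℝ) ^ 12 ≤ 2 ^ k := by exact_mod_cast mul_pow_le_two_pow hk
  refine le_of_sq_le_sq ?_ (by positivity)
  rw [← Real.rpow_natCast ((2 : ℝ) ^ _), ← Real.rpow_mul zero_le_two]
  push_cast
  rw [div_mul_cancel₀ _ two_ne_zero, Real.rpow_natCast]
  linarith

lemma floor_rpow_bounds {e : ℝ} (he : 0 < e) (he' : e < (1 / 1000 : ℝ) ^ ((4 : ℝ) ^ 2)) :
    1000 ≤ ⌊e ^ (-1 / (4 : ℝ) ^ 2 : ℝ)⌋₊ ∧ e * (⌊e ^ (-1 / (4 : ℝ) ^ 2 : ℝ)⌋₊ : ℝ) ^ 16 ≤ 1 := by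
  have h16 : (4 : ℝ) ^ 2 = ((16 : ℕ) : ℝ) := by norm_num
  rw [h16] at he' ⊢
  have hy : (0 : ℝ) < e ^ (-1 / ((16 : ℕ) : ℝ)) := Real.rpow_pos_of_pos he _
  have hpow : (e ^ (-1 / ((16 : ℕ) : ℝ))) ^ 16 = e⁻¹ := by
    rw [← Real.rpow_natCast, ← Real.rpow_mul he.le, div_mul_cancel₀ _ (by norm_num),
      Real.rpow_neg_one]
  rw [Real.rpow_natCast] at he'
  refine ⟨Nat.le_floor ?_, ?_⟩
  · refine le_of_pow_le_pow_left₀ (n := 16) (by norm_num) hy.le ?_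
    rw [hpow, le_inv_comm₀ (by positivity) he]
    refine he'.le.trans (le_of_eq ?_)
    norm_num
  · calc _ ≤ e * (e ^ (-1 / ((16 : ℕ) : ℝ))) ^ 16 := by
          gcongr
          exact Nat.floor_le hy.le
      _ = 1 := by rw [hpow, mul_inv_cancel₀ he.ne']

/-- Proposition 5.9: exponential lower bound from blowups of `U_bg(K)`. -/
theorem stmt_15 :
    ∃ K₁ eStar : ℝ, 0 < K₁ ∧ 0 < eStar ∧
      ∀ ε₁ : ℝ, 0 < ε₁ → ε₁ < eStar ^ (K₁ ^ 2) →
        ∃ ε₂Star : ℕ → ℝ, (∀ x, 0 < ε₂Star x ∧ ε₂Star x < 1) ∧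
          ∀ t : ℕ, 1 ≤ t →
            ∀ ε₂ : ℕ → ℝ, (∀ x, 0 < ε₂ x ∧ ε₂ x < 1) → (∀ x, ε₂ x < ε₂Star x) →
              ∃ ε : ℝ, 0 < ε ∧ ∃ n₀ : ℕ, ∀ n : ℕ, n₀ ≤ n →
                ∀ K : ℕ, K = ⌊ε₁ ^ (-1 / K₁ ^ 2 : ℝ)⌋₊ → K ∣ n →
                  ∀ Γ : BipColored (Ubg K).left, Γ.A.card = n → Γ.B.card = n →
                    (∀ u ∈ (Ubg K).left, (Γ.colorBG u).EpsRegular ε ∧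
                      |(Γ.colorBG u).density - ((2 : ℝ) ^ K)⁻¹| ≤ ε) →
                    ∀ H : ThreeGraph, IsBlowup (Ubg K) (n / K) Γ H →
                      ∀ ℓ : ℕ, 1 ≤ ℓ →
                        ∀ P : Decomp H.verts (Fin t) (Fin ℓ),
                          P.isReg (ε₁ ^ K₁) ((ε₂ ℓ) ^ K₁) →
                          P.regWrt H.obar (ε₁ ^ K₁) ((ε₂ ℓ) ^ K₁) →
                          (2 : ℝ) ^ ((K : ℝ) / 2) ≤ (ℓ : ℝ) := by

  refine ⟨4, 1 / 1000, by norm_num, by norm_num, fun ε₁ hε₁ hε₁' => ?_⟩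
  obtain ⟨hK, hεK⟩ := floor_rpow_bounds hε₁ hε₁'
  set K₀ := ⌊ε₁ ^ (-1 / (4 : ℝ) ^ 2 : ℝ)⌋₊ with hK₀
  have hK' : (1000 : ℝ) ≤ K₀ := by exact_mod_cast hK
  have hKpos : (0 : ℝ) < K₀ := by linarith
  have hμ1 : 1 / (K₀ : ℝ) ^ 3 ≤ 1 := by
    rw [div_le_one (by positivity)]
    exact one_le_pow₀ (by linarith)
  have hε64 : ε₁ ^ 4 * (K₀ : ℝ) ^ 64 ≤ 1 := by
    calc ε₁ ^ 4 * (K₀ : ℝ) ^ 64 = (ε₁ * (K₀ : ℝ) ^ 16) ^ 4 := by ring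
      _ ≤ 1 := pow_le_one₀ (by positivity) hεK
  have hbase : ∀ x : ℕ, 0 < 1 / (K₀ : ℝ) ^ 3 / (2 * K₀) / (x + 1) ∧
      1 / (K₀ : ℝ) ^ 3 / (2 * K₀) / (x + 1) ≤ 1 := by
    refine fun x => ⟨by positivity, ?_⟩
    refine (div_le_self (by positivity) (by linarith [Nat.cast_nonneg (α := ℝ) x])).trans ?_
    exact (div_le_self (by positivity) (by linarith)).trans hμ1
  refine ⟨fun x => ((1 / (K₀ : ℝ) ^ 3 / (2 * K₀) / (x + 1)) ^ 13 / 8) ^ 4, fun x => ?_, ?_⟩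
  · obtain ⟨h0, h1⟩ := hbase x
    refine ⟨by positivity, pow_lt_one₀ (by positivity) ?_ (by norm_num)⟩
    have := pow_le_one₀ (n := 13) h0.le h1
    linarith
  intro t ht ε₂ hε₂ hε₂'
  have ht' : (0 : ℝ) < t := by exact_mod_cast ht
  refine ⟨min ((2 : ℝ) ^ K₀)⁻¹ (1 / (K₀ : ℝ) ^ 3 / t), by positivity, 1, ?_⟩
  rintro n hn K rfl hKn Γ hA hB hΓ H hH ℓ - P - hP
  have h4 : (4 : ℝ) = ((4 : ℕ) : ℝ) := by norm_num
  rw [h4, Real.rpow_natCast, Real.rpow_natCast] at hP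
  have hε₂4 : ε₂ ℓ ^ 4 ≤ ε₂ ℓ := pow_le_of_le_one (hε₂ ℓ).1.le (hε₂ ℓ).2.le (by norm_num)
  have hmain := le_of_regWrt_blowup hH P hKn hn ht hA hB hΓ (min_le_right _ _) (min_le_left _ _)
    (by positivity) hμ1 ?_ (by positivity) ?_ ?_ (hε₂4.trans (hε₂' ℓ).le) hP
  · have h2 := six_mul_pow_le_two_rpow hK
    have h3 : (2 : ℝ) ^ ((K₀ : ℝ) / 2) * (2 : ℝ) ^ ((K₀ : ℝ) / 2) = 2 ^ K₀ := by
      rw [← Real.rpow_add two_pos, add_halves, Real.rpow_natCast]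
    rw [div_pow, one_pow, ← pow_mul, div_mul_eq_mul_div, div_le_iff₀ (by positivity), one_mul,
      ← h3] at hmain
    refine le_of_mul_le_mul_right ?_ (Real.rpow_pos_of_pos two_pos ((K₀ : ℝ) / 2))
    calc _ ≤ 6 * (ℓ : ℝ) * (K₀ : ℝ) ^ (3 * 2) := hmain
      _ = ℓ * (6 * (K₀ : ℝ) ^ 6) := by ring
      _ ≤ _ := by gcongr
  · rw [mul_one_div, div_mul_eq_mul_div, div_lt_one (by positivity)]
    nlinarith [pow_pos hKpos 2]
  · rw [le_div_iff₀ (by positivity)]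
    refine le_trans ?_ hε64
    gcongr
    · linarith
    · norm_num
  · have h5 : (2 : ℝ) ^ 28 < (K₀ : ℝ) ^ 40 := by
      calc (2 : ℝ) ^ 28 < 1000 ^ 40 := by norm_num
        _ ≤ _ := by gcongr
    rw [div_div, div_pow, one_pow, lt_div_iff₀ (by positivity)]
    calc 2 ^ 22 * ε₁ ^ 4 * ((K₀ : ℝ) ^ 3 * (2 * K₀)) ^ 6
        = ε₁ ^ 4 * (K₀ : ℝ) ^ 24 * 2 ^ 28 := by ring
      _ < ε₁ ^ 4 * (K₀ : ℝ) ^ 24 * (K₀ : ℝ) ^ 40 := by gcongr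
      _ = ε₁ ^ 4 * (K₀ : ℝ) ^ 64 := by ring
      _ ≤ 1 := hε64
end

section
/- There are constants K₁, ε*>0 such that the following holds. Suppose 𝒢=(U,V;E) is an irreducible bigraph and 0<ε₁<min{|U|^{-K₁}, |V|^{-K₁}, (ε*)^{K₁}}. There exists ε₂*:ℕ→(0,1) such that for all t≥1 and all ε₂:ℕ→(0,1) with ε₂(x)<ε₂*(x) for all x, there is ε>0 such that for all sufficiently large n: if Γ=(A∪B,(P_u)_{u∈U}) is a bipartite U-colored graph with |A|=|B|=n such that for each u∈U, (A∪B,P_u) is ε-regular with density |U|^{-1} ± ε, H is an (n/|V|,Γ)-blowup of 𝒢, and 𝒫 is a dev_{2,3}(ε₁^{K₁},ε₂(ℓ)^{K₁})-regular (t,ℓ,ε₁^{K₁},ε₂(ℓ)^{K₁})-decomposition of H, then ℓ ≥ |U|. -/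
open scoped Classical
open Finset

set_option maxHeartbeats 1000000

section CauchySchwarz

variable {α β γ : Type*}

lemma sq_sum_mul_le_card_mul_sum_sq (s : Finset α) (a f : α → ℝ) (ha : ∀ i ∈ s, |a i| ≤ 1) :
    (∑ i ∈ s, a i * f i) ^ 2 ≤ (s.card : ℝ) * ∑ i ∈ s, f i ^ 2 := by
  refine (sq_sum_le_card_mul_sum_sq (s := s) (f := fun i => a i * f i)).trans ?_
  refine mul_le_mul_of_nonneg_left (Finset.sum_le_sum fun i hi => ?_) (Nat.cast_nonneg _)
  rw [mul_pow]
  have : a i ^ 2 ≤ 1 := (sq_le_one_iff_abs_le_one _).2 (ha i hi)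
  exact mul_le_of_le_one_left (sq_nonneg _) this

lemma sq_sum_sum_mul_le (s : Finset α) (t : Finset β) (a f : α → β → ℝ)
    (ha : ∀ i ∈ s, ∀ j ∈ t, |a i j| ≤ 1) :
    (∑ i ∈ s, ∑ j ∈ t, a i j * f i j) ^ 2 ≤
      (s.card : ℝ) * (t.card : ℝ) * ∑ i ∈ s, ∑ j ∈ t, f i j ^ 2 := by
  have := sq_sum_mul_le_card_mul_sum_sq (s ×ˢ t) (fun p => a p.1 p.2) (fun p => f p.1 p.2)
    (fun p hp => ha _ (Finset.mem_product.1 hp).1 _ (Finset.mem_product.1 hp).2)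
  simpa [Finset.sum_product, Finset.card_product] using this

lemma sq_sum_sum_le (s : Finset α) (t : Finset β) (f : α → β → ℝ) :
    (∑ i ∈ s, ∑ j ∈ t, f i j) ^ 2 ≤
      (s.card : ℝ) * (t.card : ℝ) * ∑ i ∈ s, ∑ j ∈ t, f i j ^ 2 := by
  simpa using sq_sum_sum_mul_le s t (fun _ _ => 1) f (by simp)

/-- The Gowers–Cauchy–Schwarz inequality for the box norm of a function of two variables. -/
lemma pow_four_sum_le_box (X : Finset α) (Y : Finset β) (F : α → β → ℝ) :
    (∑ x ∈ X, ∑ y ∈ Y, F x y) ^ 4 ≤ ((X.card : ℝ) * Y.card) ^ 2 *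
      ∑ x₀ ∈ X, ∑ x₁ ∈ X, ∑ y₀ ∈ Y, ∑ y₁ ∈ Y,
        (F x₀ y₀ * F x₁ y₀) * (F x₀ y₁ * F x₁ y₁) := by
  set T : ℝ := ∑ x₀ ∈ X, ∑ x₁ ∈ X, ∑ y ∈ Y, F x₀ y * F x₁ y with hT
  have hTe : T = ∑ y ∈ Y, (∑ x ∈ X, F x y) ^ 2 := by
    simp_rw [sq, Finset.sum_mul_sum]
    rw [Finset.sum_comm, hT]
    exact Finset.sum_congr rfl fun _ _ => Finset.sum_comm
  have h1 : (∑ x ∈ X, ∑ y ∈ Y, F x y) ^ 2 ≤ (Y.card : ℝ) * T := by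
    rw [Finset.sum_comm, hTe]
    exact sq_sum_le_card_mul_sum_sq
  have h2 : T ^ 2 ≤ (X.card : ℝ) * X.card *
      ∑ x₀ ∈ X, ∑ x₁ ∈ X, ∑ y₀ ∈ Y, ∑ y₁ ∈ Y, (F x₀ y₀ * F x₁ y₀) * (F x₀ y₁ * F x₁ y₁) := by
    refine (sq_sum_sum_le X X _).trans_eq ?_
    simp_rw [sq, Finset.sum_mul_sum]
  calc (∑ x ∈ X, ∑ y ∈ Y, F x y) ^ 4 = ((∑ x ∈ X, ∑ y ∈ Y, F x y) ^ 2) ^ 2 := by ring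
    _ ≤ ((Y.card : ℝ) * T) ^ 2 := pow_le_pow_left₀ (sq_nonneg _) h1 2
    _ = (Y.card : ℝ) ^ 2 * T ^ 2 := by ring
    _ ≤ (Y.card : ℝ) ^ 2 * _ := mul_le_mul_of_nonneg_left h2 (by positivity)
    _ = _ := by ring

lemma sum_comm_four (Z : Finset γ) (X : Finset α) (Y : Finset β)
    (f : γ → α → α → β → β → ℝ) :
    ∑ z ∈ Z, ∑ x₀ ∈ X, ∑ x₁ ∈ X, ∑ y₀ ∈ Y, ∑ y₁ ∈ Y, f z x₀ x₁ y₀ y₁ =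
      ∑ x₀ ∈ X, ∑ x₁ ∈ X, ∑ y₀ ∈ Y, ∑ y₁ ∈ Y, ∑ z ∈ Z, f z x₀ x₁ y₀ y₁ := by
  rw [Finset.sum_comm]
  refine Finset.sum_congr rfl fun _ _ => ?_
  rw [Finset.sum_comm]
  refine Finset.sum_congr rfl fun _ _ => ?_
  rw [Finset.sum_comm]
  refine Finset.sum_congr rfl fun _ _ => ?_
  rw [Finset.sum_comm]

/-- A correlation of `h` with a function of `(x, y)` times a function of `z` is controlled by the
octahedral sum of `h`. -/
lemma pow_eight_sum_le_octahedral (X : Finset α) (Y : Finset β) (Z : Finset γ)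
    (h : α → β → γ → ℝ) (a : α → β → ℝ) (c : γ → ℝ)
    (ha : ∀ x ∈ X, ∀ y ∈ Y, |a x y| ≤ 1) (hc : ∀ z ∈ Z, |c z| ≤ 1) :
    (∑ x ∈ X, ∑ y ∈ Y, a x y * ∑ z ∈ Z, c z * h x y z) ^ 8 ≤
      ((X.card : ℝ) * Y.card * Z.card) ^ 6 *
      ∑ x₀ ∈ X, ∑ x₁ ∈ X, ∑ y₀ ∈ Y, ∑ y₁ ∈ Y, ∑ z₀ ∈ Z, ∑ z₁ ∈ Z,
        h x₀ y₀ z₀ * h x₀ y₀ z₁ * h x₀ y₁ z₀ * h x₀ y₁ z₁ *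
          h x₁ y₀ z₀ * h x₁ y₀ z₁ * h x₁ y₁ z₀ * h x₁ y₁ z₁ := by
  set S : ℝ := ∑ x ∈ X, ∑ y ∈ Y, a x y * ∑ z ∈ Z, c z * h x y z with hS
  set D : ℝ := ∑ x₀ ∈ X, ∑ x₁ ∈ X, ∑ y₀ ∈ Y, ∑ y₁ ∈ Y, ∑ z₀ ∈ Z, ∑ z₁ ∈ Z,
        h x₀ y₀ z₀ * h x₀ y₀ z₁ * h x₀ y₁ z₀ * h x₀ y₁ z₁ *
          h x₁ y₀ z₀ * h x₁ y₀ z₁ * h x₁ y₁ z₀ * h x₁ y₁ z₁ with hD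
  set W : γ → γ → ℝ := fun z₀ z₁ => ∑ x ∈ X, ∑ y ∈ Y, h x y z₀ * h x y z₁ with hW
  set T : ℝ := ∑ z₀ ∈ Z, ∑ z₁ ∈ Z, (c z₀ * c z₁) * W z₀ z₁ with hT
  have hTe : ∑ x ∈ X, ∑ y ∈ Y, (∑ z ∈ Z, c z * h x y z) ^ 2 = T := by
    have : ∀ x ∈ X, ∑ y ∈ Y, (∑ z ∈ Z, c z * h x y z) ^ 2 =
        ∑ z₀ ∈ Z, ∑ z₁ ∈ Z, ∑ y ∈ Y, (c z₀ * c z₁) * (h x y z₀ * h x y z₁) := by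
      intro x _
      simp_rw [sq, Finset.sum_mul_sum]
      rw [Finset.sum_comm]
      refine Finset.sum_congr rfl fun _ _ => ?_
      rw [Finset.sum_comm]
      exact Finset.sum_congr rfl fun _ _ => Finset.sum_congr rfl fun _ _ => by ring
    rw [Finset.sum_congr rfl this, Finset.sum_comm]
    refine Finset.sum_congr rfl fun _ _ => ?_
    rw [Finset.sum_comm]
    refine Finset.sum_congr rfl fun _ _ => ?_
    simp_rw [hW, Finset.mul_sum]
  have h1 : S ^ 2 ≤ (X.card : ℝ) * Y.card * T := hTe ▸ sq_sum_sum_mul_le X Y a _ ha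
  have h2 : T ^ 2 ≤ (Z.card : ℝ) * Z.card * ∑ z₀ ∈ Z, ∑ z₁ ∈ Z, W z₀ z₁ ^ 2 := by
    refine sq_sum_sum_mul_le Z Z (fun z₀ z₁ => c z₀ * c z₁) W fun i hi j hj => ?_
    rw [abs_mul]
    exact mul_le_one₀ (hc i hi) (abs_nonneg _) (hc j hj)
  have h3 : (∑ z₀ ∈ Z, ∑ z₁ ∈ Z, W z₀ z₁ ^ 2) ^ 2 ≤
      (Z.card : ℝ) * Z.card * (((X.card : ℝ) * Y.card) ^ 2 * D) := by
    refine (sq_sum_sum_le Z Z _).trans (mul_le_mul_of_nonneg_left ?_ (by positivity))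
    have : ∀ z₀ z₁, (W z₀ z₁ ^ 2) ^ 2 ≤ ((X.card : ℝ) * Y.card) ^ 2 *
      ∑ x₀ ∈ X, ∑ x₁ ∈ X, ∑ y₀ ∈ Y, ∑ y₁ ∈ Y,
        h x₀ y₀ z₀ * h x₀ y₀ z₁ * h x₀ y₁ z₀ * h x₀ y₁ z₁ *
          h x₁ y₀ z₀ * h x₁ y₀ z₁ * h x₁ y₁ z₀ * h x₁ y₁ z₁ := by
      intro z₀ z₁
      rw [← pow_mul]
      refine (pow_four_sum_le_box X Y fun x y => h x y z₀ * h x y z₁).trans_eq ?_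
      congr 1
      refine Finset.sum_congr rfl fun _ _ => Finset.sum_congr rfl fun _ _ =>
        Finset.sum_congr rfl fun _ _ => Finset.sum_congr rfl fun _ _ => by ring
    refine (Finset.sum_le_sum fun z₀ _ => Finset.sum_le_sum fun z₁ _ => this z₀ z₁).trans_eq ?_
    simp_rw [← Finset.mul_sum]
    congr 1
    rw [hD, ← sum_comm_four Z X Y]
    exact Finset.sum_congr rfl fun z _ => sum_comm_four Z X Y _
  calc S ^ 8 = ((S ^ 2) ^ 2) ^ 2 := by ring
    _ ≤ (((X.card : ℝ) * Y.card * T) ^ 2) ^ 2 := by gcongr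
    _ = ((X.card : ℝ) * Y.card) ^ 4 * (T ^ 2) ^ 2 := by ring
    _ ≤ ((X.card : ℝ) * Y.card) ^ 4 *
        ((Z.card : ℝ) * Z.card * ∑ z₀ ∈ Z, ∑ z₁ ∈ Z, W z₀ z₁ ^ 2) ^ 2 := by gcongr
    _ = ((X.card : ℝ) * Y.card) ^ 4 * (Z.card : ℝ) ^ 4 *
        (∑ z₀ ∈ Z, ∑ z₁ ∈ Z, W z₀ z₁ ^ 2) ^ 2 := by ring
    _ ≤ ((X.card : ℝ) * Y.card) ^ 4 * (Z.card : ℝ) ^ 4 *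
        ((Z.card : ℝ) * Z.card * (((X.card : ℝ) * Y.card) ^ 2 * D)) := by gcongr
    _ = _ := by ring

end CauchySchwarz

lemma Triad.mem_K3 (G : Triad) (x y z : ℕ) :
    (x, y, z) ∈ G.K3 ↔ (x ∈ G.X ∧ y ∈ G.Y ∧ z ∈ G.Z) ∧
      (x, y) ∈ G.EXY ∧ (y, z) ∈ G.EYZ ∧ (x, z) ∈ G.EXZ := by
  simp [Triad.K3]

/-- The octahedral sum bounds the correlation of `hFun` with the indicator of a set of triples
defined by a condition on `(x, y)` and a condition on `z`, on which `hFun` takes a single value. -/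
lemma abs_mul_card_filter_K3_le (R : Finset (ℕ × ℕ × ℕ)) (G : Triad) (p : ℕ → ℕ → Prop)
    (q : ℕ → Prop) (w δ τ : ℝ) (hδ : 0 ≤ δ) (hτ : τ ≤ δ ^ 8)
    (hdev : devSum3 R G ≤ τ * ((G.X.card : ℝ) * G.Y.card * G.Z.card) ^ 2)
    (hw : ∀ x y z, (x, y, z) ∈ G.K3 → p x y → q z → hFun R G x y z = w) :
    |w * ((G.K3.filter fun e => p e.1 e.2.1 ∧ q e.2.2).card : ℝ)| ≤
      δ * ((G.X.card : ℝ) * G.Y.card * G.Z.card) := by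
  have hS : w * ((G.K3.filter fun e => p e.1 e.2.1 ∧ q e.2.2).card : ℝ) =
      ∑ x ∈ G.X, ∑ y ∈ G.Y, (if p x y then (1 : ℝ) else 0) *
        ∑ z ∈ G.Z, (if q z then (1 : ℝ) else 0) * hFun R G x y z := by
    have h1 : w * ((G.K3.filter fun e => p e.1 e.2.1 ∧ q e.2.2).card : ℝ) =
        ∑ e ∈ G.X ×ˢ G.Y ×ˢ G.Z,
          if e ∈ G.K3 ∧ p e.1 e.2.1 ∧ q e.2.2 then w else 0 := by
      rw [← Finset.sum_filter, Finset.sum_const, nsmul_eq_mul, mul_comm]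
      congr 3
      ext e
      simp only [Finset.mem_filter]
      refine ⟨fun h => ⟨(Finset.mem_filter.1 h.1).1, h⟩, fun h => h.2⟩
    rw [h1, Finset.sum_product]
    refine Finset.sum_congr rfl fun x _ => ?_
    rw [Finset.sum_product]
    refine Finset.sum_congr rfl fun y _ => ?_
    rw [Finset.mul_sum]
    refine Finset.sum_congr rfl fun z _ => ?_
    by_cases hK : (x, y, z) ∈ G.K3 <;> by_cases hp : p x y <;> by_cases hq : q z <;>
      simp [hK, hp, hq]
    · exact (hw x y z hK hp hq).symm
    · simp [hFun, hK]
  rw [hS]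
  refine le_of_pow_le_pow_left₀ (n := 8) (by norm_num) (by positivity) ?_
  rw [Even.pow_abs (by decide)]
  refine (pow_eight_sum_le_octahedral G.X G.Y G.Z (hFun R G) _ _ ?_ ?_).trans ?_
  · intro x _ y _; split_ifs <;> simp
  · intro z _; split_ifs <;> simp
  · change _ * devSum3 R G ≤ _
    calc _ ≤ ((G.X.card : ℝ) * G.Y.card * G.Z.card) ^ 6 *
          (δ ^ 8 * ((G.X.card : ℝ) * G.Y.card * G.Z.card) ^ 2) := by
          refine mul_le_mul_of_nonneg_left (hdev.trans ?_) (by positivity)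
          exact mul_le_mul_of_nonneg_right hτ (by positivity)
      _ = _ := by ring

/-- On a regular triad, a relation that depends only on the first two coordinates over a box is
nearly constant there. -/
lemma exists_card_filter_not_iff_le (R : Finset (ℕ × ℕ × ℕ)) (G : Triad) (Q : ℕ → ℕ → Prop)
    (A B C : Finset ℕ) (hQ : ∀ x ∈ A, ∀ y ∈ B, ∀ z ∈ C, (x, y, z) ∈ R ↔ Q x y)
    (ε₁ ε₂ η : ℝ) (hε₁ : 0 ≤ ε₁) (hε₂ : ε₂ ≤ 1) (hη : 0 ≤ η) (hε : 2 ^ 20 * ε₁ ≤ η ^ 8)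
    (hG : dev23 R G ε₁ ε₂) :
    ∃ b : Prop, ((G.K3.filter fun e =>
        (e.1 ∈ A ∧ e.2.1 ∈ B ∧ ¬ (Q e.1 e.2.1 ↔ b)) ∧ e.2.2 ∈ C).card : ℝ) ≤
      η * ((G.X.card : ℝ) * G.Y.card * G.Z.card) := by
  obtain ⟨d₁, d₂, d₃, hd₁, hd₂, hd₃, h₁, h₃, h₂, hdev⟩ := hG
  have two : ∀ (B : Bigraph) (d : ℝ), B.dev2 ε₂ d → d ≤ 2 := by
    intro B d h
    have := (abs_le.1 h.1).1
    have := B.density_le_one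
    linarith
  have hdev' : devSum3 R G ≤ 2 ^ 12 * ε₁ * ((G.X.card : ℝ) * G.Y.card * G.Z.card) ^ 2 := by
    refine hdev.trans ?_
    have e₁ : d₁ ^ 4 ≤ 2 ^ 4 := pow_le_pow_left₀ hd₁.le (two _ _ h₁) 4
    have e₂ : d₂ ^ 4 ≤ 2 ^ 4 := pow_le_pow_left₀ hd₂.le (two _ _ h₂) 4
    have e₃ : d₃ ^ 4 ≤ 2 ^ 4 := pow_le_pow_left₀ hd₃.le (two _ _ h₃) 4
    calc _ = ε₁ * (d₁ ^ 4 * d₂ ^ 4 * d₃ ^ 4) *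
          ((G.X.card : ℝ) * G.Y.card * G.Z.card) ^ 2 := by ring
      _ ≤ ε₁ * (2 ^ 4 * 2 ^ 4 * 2 ^ 4) * ((G.X.card : ℝ) * G.Y.card * G.Z.card) ^ 2 := by
        gcongr
      _ = _ := by ring
  have hτ : 2 ^ 12 * ε₁ ≤ (η / 2) ^ 8 := by
    rw [div_pow]; linarith
  have key := fun (p : ℕ → ℕ → Prop) w => abs_mul_card_filter_K3_le R G p (fun z => z ∈ C) w
    (η / 2) (2 ^ 12 * ε₁) (by positivity) hτ hdev'
  have const : ∀ (b : Prop) (w : ℝ), 1 / 2 ≤ |w| →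
      (∀ x y z, (x, y, z) ∈ G.K3 → (x ∈ A ∧ y ∈ B ∧ ¬ (Q x y ↔ b)) → z ∈ C →
        hFun R G x y z = w) →
      ((G.K3.filter fun e =>
        (e.1 ∈ A ∧ e.2.1 ∈ B ∧ ¬ (Q e.1 e.2.1 ↔ b)) ∧ e.2.2 ∈ C).card : ℝ) ≤
      η * ((G.X.card : ℝ) * G.Y.card * G.Z.card) := by
    intro b w hw hh
    have := key (fun x y => x ∈ A ∧ y ∈ B ∧ ¬ (Q x y ↔ b)) w hh
    rw [abs_mul, Nat.abs_cast] at this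
    have h : |w| * ((G.K3.filter fun e =>
        (e.1 ∈ A ∧ e.2.1 ∈ B ∧ ¬ (Q e.1 e.2.1 ↔ b)) ∧ e.2.2 ∈ C).card : ℝ) ≤
        η / 2 * ((G.X.card : ℝ) * G.Y.card * G.Z.card) := by
      convert this
      rfl
    have := mul_le_mul_of_nonneg_right hw (Nat.cast_nonneg (α := ℝ) (G.K3.filter fun e =>
        (e.1 ∈ A ∧ e.2.1 ∈ B ∧ ¬ (Q e.1 e.2.1 ↔ b)) ∧ e.2.2 ∈ C).card)
    linarith
  rcases le_total (relDensity R G) (1 / 2) with h | h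
  · refine ⟨False, const _ (1 - relDensity R G) (le_abs.2 (Or.inl (by linarith))) ?_⟩
    rintro x y z hK ⟨hA, hB, hn⟩ hC
    have : (x, y, z) ∈ R := (hQ x hA y hB z hC).2 (by tauto)
    simp [hFun, hK, this]
  · refine ⟨True, const _ (-relDensity R G) (le_abs.2 (Or.inr (by linarith))) ?_⟩
    rintro x y z hK ⟨hA, hB, hn⟩ hC
    have : (x, y, z) ∉ R := fun h => hn (by simpa using (hQ x hA y hB z hC).1 h)
    simp [hFun, hK, this]

/-- If every color class of `Γ` is regular with density close to `1/|U|`, then a guess of the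
color of `(x, y)` from a type of `x`, a type of `y` and a label with fewer than `|U|` values is
often wrong. -/
lemma card_wrong_color_ge {U : Finset ℕ} (Γ : BipColored U) {n : ℕ} (hA : Γ.A.card = n)
    (hB : Γ.B.card = n) {ε : ℝ} (hε : 0 ≤ ε)
    (hΓ : ∀ u ∈ U, (Γ.colorBG u).EpsRegular ε ∧ |(Γ.colorBG u).density - (U.card : ℝ)⁻¹| ≤ ε)
    {S : Type*} [Fintype S] {ℓ : ℕ} (hℓ : ℓ < U.card) (f g : ℕ → S) (l : ℕ → ℕ → Fin ℓ)
    (F : S → S → Fin ℓ → ℕ) :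
    ((U.card : ℝ)⁻¹ - 2 * ε - 2 * Fintype.card S * ε) * (n : ℝ) ^ 2 ≤
      (((Γ.A ×ˢ Γ.B).filter fun p =>
        ∃ u ∈ U, p ∈ (Γ.colorBG u).edges ∧ u ≠ F (f p.1) (g p.2) (l p.1 p.2)).card : ℝ) := by
  set N := (Γ.A ×ˢ Γ.B).filter fun p =>
    ∃ u ∈ U, p ∈ (Γ.colorBG u).edges ∧ u ≠ F (f p.1) (g p.2) (l p.1 p.2) with hN
  set As : S → Finset ℕ := fun s => Γ.A.filter fun x => f x = s with hAs
  set Bs : S → Finset ℕ := fun s => Γ.B.filter fun y => g y = s with hBs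
  set κ : ℝ := (U.card : ℝ)⁻¹ - 2 * ε with hκ
  have hUpos : (1 : ℝ) ≤ U.card := by exact_mod_cast (Nat.zero_le ℓ).trans_lt hℓ
  have hκ1 : κ ≤ 1 := by
    have : (U.card : ℝ)⁻¹ ≤ 1 := inv_le_one_of_one_le₀ hUpos
    linarith
  have hAsum : ∑ s, ((As s).card : ℝ) = n := by
    rw [← hA, Finset.card_eq_sum_card_fiberwise (f := f) (t := Finset.univ) (by simp)]
    push_cast; rfl
  have hBsum : ∑ s, ((Bs s).card : ℝ) = n := by
    rw [← hB, Finset.card_eq_sum_card_fiberwise (f := g) (t := Finset.univ) (by simp)]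
    push_cast; rfl
  have hcell : ∀ a b : S, κ * ((As a).card * (Bs b).card) - ε * n * (Bs b).card
      - ε * n * (As a).card ≤ ((N.filter fun p => (f p.1, g p.2) = (a, b)).card : ℝ) := by
    intro a b
    have hAle : ((As a).card : ℝ) ≥ 0 := Nat.cast_nonneg _
    have hBle : ((Bs b).card : ℝ) ≥ 0 := Nat.cast_nonneg _
    have hn0 : (n : ℝ) ≥ 0 := Nat.cast_nonneg _
    have hnn : (0 : ℝ) ≤ ((N.filter fun p => (f p.1, g p.2) = (a, b)).card : ℝ) :=
      Nat.cast_nonneg _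
    have hAB := mul_nonneg hAle hBle
    have hεA := mul_nonneg (mul_nonneg hε hn0) hAle
    have hεB := mul_nonneg (mul_nonneg hε hn0) hBle
    rcases lt_or_ge ((As a).card : ℝ) (ε * n) with h | h1
    · nlinarith
    rcases lt_or_ge ((Bs b).card : ℝ) (ε * n) with h | h2
    · nlinarith
    obtain ⟨u, hu, huF⟩ : ∃ u ∈ U, u ∉ Finset.univ.image (F a b) := by
      by_contra! hcon
      have := (Finset.card_le_card hcon).trans Finset.card_image_le
      simp at this
      omega
    obtain ⟨hreg, hden⟩ := hΓ u hu
    have h3 := hreg (As a) (Finset.filter_subset _ _) (Bs b) (Finset.filter_subset _ _)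
      (by simpa [BipColored.colorBG, hA] using h1) (by simpa [BipColored.colorBG, hB] using h2)
    have h4 : κ ≤ (Γ.colorBG u).dBetween (As a) (Bs b) := by
      have := (abs_le.1 h3).2
      have := (abs_le.1 hden).1
      linarith
    have h5 : κ * ((As a).card * (Bs b).card) ≤
        (((Γ.colorBG u).edges ∩ As a ×ˢ Bs b).card : ℝ) := by
      rcases hAB.eq_or_lt with h0 | h0
      · rw [← h0]; simp
      · exact (le_div_iff₀ h0).1 h4
    have h6 : (((Γ.colorBG u).edges ∩ As a ×ˢ Bs b).card : ℝ) ≤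
        ((N.filter fun p => (f p.1, g p.2) = (a, b)).card : ℝ) := by
      refine Nat.cast_le.2 (Finset.card_le_card fun p hp => ?_)
      simp only [Finset.mem_inter, Finset.mem_product, hAs, hBs, Finset.mem_filter] at hp
      simp only [hN, Finset.mem_filter, Finset.mem_product, Prod.mk.injEq]
      refine ⟨⟨⟨hp.2.1.1, hp.2.2.1⟩, u, hu, hp.1, ?_⟩, hp.2.1.2, hp.2.2.2⟩
      rintro rfl
      apply huF
      rw [hp.2.1.2, hp.2.2.2]
      exact Finset.mem_image_of_mem _ (Finset.mem_univ _)
    linarith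
  have hNsum : (N.card : ℝ) =
      ∑ a, ∑ b, ((N.filter fun p => (f p.1, g p.2) = (a, b)).card : ℝ) := by
    rw [Finset.card_eq_sum_card_fiberwise (f := fun p => (f p.1, g p.2)) (t := Finset.univ)
      (by simp), Fintype.sum_prod_type]
    push_cast; rfl
  rw [hNsum]
  refine le_trans (le_of_eq ?_) (Finset.sum_le_sum fun a _ => Finset.sum_le_sum fun b _ =>
    hcell a b)
  simp only [Finset.sum_sub_distrib, ← Finset.mul_sum, hBsum, ← Finset.sum_mul, hAsum,
    Finset.sum_const, nsmul_eq_mul, Finset.card_univ]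
  ring

lemma Decomp.index_eq {V : Finset ℕ} {ι κ : Type} (P : Decomp V ι κ) {x : ℕ} {i j : ι}
    (hi : x ∈ P.part i) (hj : x ∈ P.part j) : i = j := by
  by_contra h
  exact Finset.disjoint_left.1 (P.part_disj i j h) hi hj

lemma Decomp.label_eq {V : Finset ℕ} {ι κ : Type} (P : Decomp V ι κ) {p : ℕ × ℕ} {i j : ι}
    {α β : κ} (hα : p ∈ P.pairs i j α) (hβ : p ∈ P.pairs i j β) : α = β := by
  by_contra h
  exact Finset.disjoint_left.1 (P.pairs_disj i j α β h) hα hβ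

lemma Decomp.sum_card_part_le {V : Finset ℕ} {ι κ : Type} [Fintype ι] (P : Decomp V ι κ) :
    ∑ i, ((P.part i).card : ℝ) ≤ V.card := by
  rw [← Nat.cast_sum, ← Finset.card_biUnion fun i _ j _ h => P.part_disj i j h]
  exact_mod_cast Finset.card_le_card (Finset.biUnion_subset.2 fun i _ => P.part_sub i)

/-- A relation on `A × B` that records membership in `R` of triples over `A × B × C` is, up to few
exceptions, determined by the labels of a regular decomposition with respect to one vertex of
`C`. -/
lemma Decomp.exists_vertex_determining {V : Finset ℕ} {t ℓ : ℕ} (P : Decomp V (Fin t) (Fin ℓ))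
    (π : ℕ → Fin t) (lab : ℕ → ℕ → Fin ℓ) (hπ : ∀ x ∈ V, x ∈ P.part (π x))
    (hlab : ∀ x ∈ V, ∀ y ∈ V, (x, y) ∈ P.pairs (π x) (π y) (lab x y))
    (R : Finset (ℕ × ℕ × ℕ)) (Q : ℕ → ℕ → Prop) (A B C : Finset ℕ)
    (hA : A ⊆ V) (hB : B ⊆ V) (hC : C ⊆ V) (hCne : C.Nonempty)
    (hQ : ∀ x ∈ A, ∀ y ∈ B, ∀ z ∈ C, (x, y, z) ∈ R ↔ Q x y)
    (ε₁ ε₂ η : ℝ) (hε₁ : 0 ≤ ε₁) (hε₂ : ε₂ ≤ 1) (hη : 0 ≤ η) (hε : 2 ^ 20 * ε₁ ≤ η ^ 8)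
    (hreg : P.regWrt R ε₁ ε₂) :
    ∃ z ∈ C, ∃ b : Fin t → Fin t → Fin ℓ → Fin ℓ → Fin ℓ → Prop,
      (C.card : ℝ) * (((A ×ˢ B).filter fun p => ¬ (Q p.1 p.2 ↔
        b (π p.1) (π p.2) (lab p.1 p.2) (lab p.1 z) (lab p.2 z))).card : ℝ) ≤
      (ε₁ + ℓ ^ 3 * η) * (V.card : ℝ) ^ 3 := by
  have hex : ∀ i j k α β γ, ∃ b : Prop, dev23 R (P.triadOf i j k α β γ) ε₁ ε₂ →
      (((P.triadOf i j k α β γ).K3.filter fun e =>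
        (e.1 ∈ A ∧ e.2.1 ∈ B ∧ ¬ (Q e.1 e.2.1 ↔ b)) ∧ e.2.2 ∈ C).card : ℝ) ≤
      η * ((P.part i).card * (P.part j).card * (P.part k).card) := by
    intro i j k α β γ
    by_cases hd : dev23 R (P.triadOf i j k α β γ) ε₁ ε₂
    · obtain ⟨b, hb⟩ := exists_card_filter_not_iff_le R _ Q A B C hQ ε₁ ε₂ η hε₁ hε₂ hη hε hd
      exact ⟨b, fun _ => hb⟩
    · exact ⟨True, fun h => absurd h hd⟩
  choose b hb using hex
  set good := (V ×ˢ V ×ˢ V).filter fun p =>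
      ∃ i j k α β γ, p ∈ (P.triadOf i j k α β γ).K3 ∧
        dev23 R (P.triadOf i j k α β γ) ε₁ ε₂ with hgood
  set err : ℕ → Finset (ℕ × ℕ) := fun z => (A ×ˢ B).filter fun p => ¬ (Q p.1 p.2 ↔
        b (π p.1) (π p.2) (π z) (lab p.1 p.2) (lab p.1 z) (lab p.2 z)) with herr
  set Err := (A ×ˢ B ×ˢ C).filter fun e => ¬ (Q e.1 e.2.1 ↔
        b (π e.1) (π e.2.1) (π e.2.2) (lab e.1 e.2.1) (lab e.1 e.2.2) (lab e.2.1 e.2.2)) with hErr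
  set minor : Fin t × Fin t × Fin t × Fin ℓ × Fin ℓ × Fin ℓ → Finset (ℕ × ℕ × ℕ) :=
    fun s => if dev23 R (P.triadOf s.1 s.2.1 s.2.2.1 s.2.2.2.1 s.2.2.2.2.1 s.2.2.2.2.2) ε₁ ε₂ then
      (P.triadOf s.1 s.2.1 s.2.2.1 s.2.2.2.1 s.2.2.2.2.1 s.2.2.2.2.2).K3.filter fun e =>
        (e.1 ∈ A ∧ e.2.1 ∈ B ∧
          ¬ (Q e.1 e.2.1 ↔ b s.1 s.2.1 s.2.2.1 s.2.2.2.1 s.2.2.2.2.1 s.2.2.2.2.2)) ∧ e.2.2 ∈ C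
      else ∅ with hminor
  have hsub : Err ⊆ ((V ×ˢ V ×ˢ V) \ good) ∪ Finset.univ.biUnion minor := by
    rintro ⟨x, y, z⟩ he
    simp only [hErr, Finset.mem_filter, Finset.mem_product] at he
    obtain ⟨⟨hx, hy, hz⟩, hne⟩ := he
    by_cases hg : (x, y, z) ∈ good
    · refine Finset.mem_union_right _ (Finset.mem_biUnion.2 ?_)
      obtain ⟨-, i, j, k, α, β, γ, hK, hd⟩ := Finset.mem_filter.1 hg
      refine ⟨(i, j, k, α, β, γ), Finset.mem_univ _, ?_⟩
      simp only [hminor, if_pos hd, Finset.mem_filter]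
      refine ⟨hK, ⟨hx, hy, ?_⟩, hz⟩
      obtain ⟨⟨hi, hj, hk⟩, hα, hγ, hβ⟩ := (Triad.mem_K3 _ x y z).1 hK
      obtain rfl := P.index_eq hi (hπ x (hA hx))
      obtain rfl := P.index_eq hj (hπ y (hB hy))
      obtain rfl := P.index_eq hk (hπ z (hC hz))
      obtain rfl := P.label_eq hα (hlab x (hA hx) y (hB hy))
      obtain rfl := P.label_eq hβ (hlab x (hA hx) z (hC hz))
      obtain rfl := P.label_eq hγ (hlab y (hB hy) z (hC hz))
      exact hne
    · refine Finset.mem_union_left _ (Finset.mem_sdiff.2 ⟨?_, hg⟩)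
      simp [hA hx, hB hy, hC hz]
  have hbad : (((V ×ˢ V ×ˢ V) \ good).card : ℝ) ≤ ε₁ * (V.card : ℝ) ^ 3 := by
    have h1 : (1 - ε₁) * (V.card : ℝ) ^ 3 ≤ (good.card : ℝ) := by
      unfold Decomp.regWrt at hreg
      convert hreg
    have h2 : ((V ×ˢ V ×ˢ V) \ good).card + good.card = V.card ^ 3 := by
      rw [Finset.card_sdiff_add_card_eq_card (Finset.filter_subset _ _)]
      simp only [Finset.card_product]; ring
    have h3 : (((V ×ˢ V ×ˢ V) \ good).card : ℝ) + good.card = (V.card : ℝ) ^ 3 := by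
      exact_mod_cast h2
    linarith
  have hmin : ((Finset.univ.biUnion minor).card : ℝ) ≤ ℓ ^ 3 * η * (V.card : ℝ) ^ 3 := by
    calc ((Finset.univ.biUnion minor).card : ℝ) ≤ ∑ s, ((minor s).card : ℝ) := by
          exact_mod_cast Finset.card_biUnion_le
      _ ≤ ∑ s : Fin t × Fin t × Fin t × Fin ℓ × Fin ℓ × Fin ℓ,
          η * ((P.part s.1).card * (P.part s.2.1).card * (P.part s.2.2.1).card) := by
          refine Finset.sum_le_sum fun s _ => ?_
          simp only [hminor]
          split_ifs with hd
          · exact hb _ _ _ _ _ _ hd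
          · simp only [Finset.card_empty, Nat.cast_zero]; positivity
      _ = ℓ ^ 3 * η * (∑ i, ((P.part i).card : ℝ)) ^ 3 := by
          simp only [Fintype.sum_prod_type, Finset.sum_const, Finset.card_univ, Fintype.card_fin,
            Fintype.card_prod, nsmul_eq_mul, Nat.cast_mul, ← Finset.mul_sum, ← Finset.sum_mul]
          ring
      _ ≤ _ := by
          refine mul_le_mul_of_nonneg_left (pow_le_pow_left₀ ?_ P.sum_card_part_le 3) ?_
          · exact Finset.sum_nonneg fun _ _ => Nat.cast_nonneg _
          · exact mul_nonneg (pow_nonneg (Nat.cast_nonneg _) 3) hη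
  have hErrle : (Err.card : ℝ) ≤ (ε₁ + ℓ ^ 3 * η) * (V.card : ℝ) ^ 3 := by
    have : (Err.card : ℝ) ≤
        (((V ×ˢ V ×ˢ V) \ good).card : ℝ) + (Finset.univ.biUnion minor).card := by
      exact_mod_cast (Finset.card_le_card hsub).trans (Finset.card_union_le _ _)
    linarith
  have hsum : ∑ z ∈ C, (err z).card ≤ Err.card := by
    rw [Finset.card_eq_sum_card_fiberwise (f := fun e => e.2.2) (s := Err) (t := C)]
    · refine Finset.sum_le_sum fun z hz => ?_
      refine Finset.card_le_card_of_injOn (fun p => (p.1, p.2, z)) ?_ ?_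
      · rintro ⟨x, y⟩ hp
        simp only [herr, Finset.coe_filter, Set.mem_ofPred_eq, Finset.mem_product] at hp
        simp only [hErr, Finset.coe_filter, Set.mem_ofPred_eq, Finset.mem_product,
          Finset.mem_filter]
        exact ⟨⟨⟨hp.1.1, hp.1.2, hz⟩, hp.2⟩, trivial⟩
      · rintro ⟨x, y⟩ _ ⟨x', y'⟩ _ h
        simpa using h
    · rintro ⟨x, y, z⟩ he
      simp only [hErr, Finset.coe_filter, Set.mem_ofPred_eq, Finset.mem_product] at he
      exact he.1.2.2
  obtain ⟨z, hz, hzle⟩ := Finset.exists_le_of_sum_le (s := C)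
    (f := fun z => C.card * (err z).card) (g := fun _ => Err.card) hCne (by
      rw [← Finset.mul_sum, Finset.sum_const, smul_eq_mul]
      exact Nat.mul_le_mul_left _ hsum)
  refine ⟨z, hz, fun i j α β γ => b i j (π z) α β γ, le_trans ?_ hErrle⟩
  exact_mod_cast hzle

lemma IsBlowupWith.mem_obar_iff_s16 {G : Bigraph} {k : ℕ} {Γ : BipColored G.left}
    {Cfam : ℕ → Finset ℕ} {H : ThreeGraph} (h : IsBlowupWith G k Γ Cfam H) {v x y z : ℕ}
    (hv : v ∈ G.right) (hx : x ∈ Γ.A) (hy : y ∈ Γ.B) (hz : z ∈ Cfam v) :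
    (x, y, z) ∈ H.obar ↔ ∃ u ∈ G.left, {x, y} ∈ Γ.P u ∧ (u, v) ∈ G.edges := by
  obtain ⟨-, -, -, hV, hE⟩ := h
  have hins : ({x, y, z} : Finset ℕ) = insert z {x, y} := by
    ext a; simp only [Finset.mem_insert, Finset.mem_singleton]; tauto
  have hmem : (x, y, z) ∈ H.obar ↔ insert z {x, y} ∈ H.edges := by
    rw [← hins]
    simp only [ThreeGraph.obar, Finset.mem_filter, Finset.mem_product, and_iff_right_iff_imp, hV]
    intro _
    exact ⟨Finset.mem_union_left _ (Finset.mem_union_left _ hx),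
      Finset.mem_union_left _ (Finset.mem_union_right _ hy),
      Finset.mem_union_right _ (Finset.mem_biUnion.2 ⟨v, hv, hz⟩)⟩
  rw [hmem]
  refine ⟨fun he => ?_, fun ⟨u, hu, hP, huv⟩ => (hE u hu v hv _ hP z hz).1 huv⟩
  have hcov : ({x, y} : Finset ℕ) ∈ G.left.biUnion Γ.P := by
    rw [Γ.P_cover]
    exact Finset.mem_image.2 ⟨(x, y), Finset.mk_mem_product hx hy, rfl⟩
  obtain ⟨u, hu, hP⟩ := Finset.mem_biUnion.1 hcov
  refine ⟨u, hu, hP, ?_⟩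
  by_contra huv
  exact (hE u hu v hv _ hP z hz).2 huv he

lemma BipColored.exists_color_iff {U : Finset ℕ} (Γ : BipColored U) {u : ℕ} (hu : u ∈ U)
    {e : Finset ℕ} (he : e ∈ Γ.P u) (p : ℕ → Prop) :
    (∃ u' ∈ U, e ∈ Γ.P u' ∧ p u') ↔ p u := by
  refine ⟨?_, fun h => ⟨u, hu, he, h⟩⟩
  rintro ⟨u', hu', he', h⟩
  by_cases heq : u = u'
  · exact heq ▸ h
  · exact absurd he' (Finset.disjoint_left.1 (Γ.P_disj u hu u' hu' heq) he)

lemma IsBlowupWith.card_verts_le {G : Bigraph} {k n : ℕ} {Γ : BipColored G.left}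
    {Cfam : ℕ → Finset ℕ} {H : ThreeGraph} (h : IsBlowupWith G k Γ Cfam H)
    (hA : Γ.A.card = n) (hB : Γ.B.card = n) (hn : G.right.card * k = n) :
    H.verts.card ≤ 3 * n := by
  rw [h.2.2.2.1]
  have h1 := Finset.card_union_le (Γ.A ∪ Γ.B) (G.right.biUnion Cfam)
  have h2 := Finset.card_union_le Γ.A Γ.B
  have h3 := Finset.card_biUnion_le_card_mul G.right Cfam k fun v hv => (h.1 v hv).le
  omega

lemma Decomp.exists_index {V : Finset ℕ} {t ℓ : ℕ} (P : Decomp V (Fin t) (Fin ℓ)) (ht : 1 ≤ t) :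
    ∃ π : ℕ → Fin t, ∀ x ∈ V, x ∈ P.part (π x) := by
  have : ∀ x, ∃ i, x ∈ V → x ∈ P.part i := fun x => by
    by_cases hx : x ∈ V
    · obtain ⟨i, hi⟩ := P.part_cover x hx
      exact ⟨i, fun _ => hi⟩
    · exact ⟨⟨0, ht⟩, fun h => absurd h hx⟩
  choose π hπ using this
  exact ⟨π, hπ⟩

lemma Decomp.exists_label {V : Finset ℕ} {t ℓ : ℕ} (P : Decomp V (Fin t) (Fin ℓ)) (hℓ : 1 ≤ ℓ)
    {π : ℕ → Fin t} (hπ : ∀ x ∈ V, x ∈ P.part (π x)) :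
    ∃ lab : ℕ → ℕ → Fin ℓ, ∀ x ∈ V, ∀ y ∈ V, (x, y) ∈ P.pairs (π x) (π y) (lab x y) := by
  have : ∀ x y, ∃ α, x ∈ V → y ∈ V → (x, y) ∈ P.pairs (π x) (π y) α := fun x y => by
    by_cases h : x ∈ V ∧ y ∈ V
    · obtain ⟨α, hα⟩ := P.pairs_cover _ _ (x, y)
        (Finset.mk_mem_product (hπ x h.1) (hπ y h.2))
      exact ⟨α, fun _ _ => hα⟩
    · exact ⟨⟨0, hℓ⟩, fun hx hy => absurd ⟨hx, hy⟩ h⟩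
  choose lab hlab using this
  exact ⟨lab, fun x hx y hy => hlab x y hx hy⟩

/-- A regular decomposition of a blowup of `G` with fewer labels than colors forces the colors to
be irregular or the regularity parameters to be large. -/
lemma Bigraph.Irreducible.inv_card_left_le {G : Bigraph} (hG : G.Irreducible) {k n : ℕ}
    (hn : G.right.card * k = n) (hnpos : 0 < n) {Γ : BipColored G.left}
    (hA : Γ.A.card = n) (hB : Γ.B.card = n) {ε : ℝ} (hε : 0 ≤ ε)
    (hΓ : ∀ u ∈ G.left, (Γ.colorBG u).EpsRegular ε ∧
      |(Γ.colorBG u).density - (G.left.card : ℝ)⁻¹| ≤ ε)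
    {H : ThreeGraph} (hH : IsBlowup G k Γ H) {t ℓ : ℕ} (ht : 1 ≤ t) (hℓ : 1 ≤ ℓ)
    (hℓU : ℓ < G.left.card) (P : Decomp H.verts (Fin t) (Fin ℓ)) {ε₁ ε₂ η : ℝ}
    (hε₁ : 0 ≤ ε₁) (hε₂ : ε₂ ≤ 1) (hη : 0 ≤ η) (hεη : 2 ^ 20 * ε₁ ≤ η ^ 8)
    (hreg : P.regWrt H.obar ε₁ ε₂) :
    (G.left.card : ℝ)⁻¹ - 2 * ε - 2 * (t * ℓ ^ G.right.card : ℕ) * ε ≤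
      27 * (G.right.card : ℝ) ^ 2 * (ε₁ + ℓ ^ 3 * η) := by
  obtain ⟨Cfam, hC⟩ := hH
  have hkpos : 0 < k := Nat.pos_of_mul_pos_left (hn ▸ hnpos)
  obtain ⟨π, hπ⟩ := P.exists_index ht
  obtain ⟨lab, hlab⟩ := P.exists_label hℓ hπ
  have hAV : Γ.A ⊆ H.verts := by
    rw [hC.2.2.2.1]; exact fun x hx => Finset.mem_union_left _ (Finset.mem_union_left _ hx)
  have hBV : Γ.B ⊆ H.verts := by
    rw [hC.2.2.2.1]; exact fun x hx => Finset.mem_union_left _ (Finset.mem_union_right _ hx)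
  have hCV : ∀ v ∈ G.right, Cfam v ⊆ H.verts := by
    intro v hv; rw [hC.2.2.2.1]
    exact fun x hx => Finset.mem_union_right _ (Finset.mem_biUnion.2 ⟨v, hv, hx⟩)
  set Q : ℕ → ℕ → ℕ → Prop := fun v x y =>
    ∃ u ∈ G.left, {x, y} ∈ Γ.P u ∧ (u, v) ∈ G.edges
  have hdet := fun (v : G.right) => P.exists_vertex_determining π lab hπ hlab H.obar (Q v)
    Γ.A Γ.B (Cfam v) hAV hBV (hCV v v.2)
    (Finset.card_pos.1 (by rw [hC.1 v v.2]; exact hkpos))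
    (fun x hx y hy z hz => hC.mem_obar_iff_s16 v.2 hx hy hz) ε₁ ε₂ η hε₁ hε₂ hη hεη hreg
  choose z _ b hb using hdet
  set err : G.right → Finset (ℕ × ℕ) := fun v => (Γ.A ×ˢ Γ.B).filter fun p => ¬ (Q v p.1 p.2 ↔
    b v (π p.1) (π p.2) (lab p.1 p.2) (lab p.1 (z v)) (lab p.2 (z v))) with herr
  set type : ℕ → Fin t × (G.right → Fin ℓ) := fun x => (π x, fun v => lab x (z v))
  set fits : Fin t × (G.right → Fin ℓ) → Fin t × (G.right → Fin ℓ) → Fin ℓ → ℕ → Prop :=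
    fun r s α u => u ∈ G.left ∧
      ∀ v : G.right, (u, (v : ℕ)) ∈ G.edges ↔ b v r.1 s.1 α (r.2 v) (s.2 v)
  have hwrong := card_wrong_color_ge Γ hA hB hε hΓ hℓU type type lab
    fun r s α => if h : ∃ u, fits r s α u then h.choose else 0
  have hsub : ((Γ.A ×ˢ Γ.B).filter fun p => ∃ u ∈ G.left, p ∈ (Γ.colorBG u).edges ∧
      u ≠ if h : ∃ u, fits (type p.1) (type p.2) (lab p.1 p.2) u then h.choose else 0) ⊆
      Finset.univ.biUnion err := by
    rintro ⟨x, y⟩ hp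
    obtain ⟨hxy, u, hu, hpu, hne⟩ := Finset.mem_filter.1 hp
    have hcol : {x, y} ∈ Γ.P u := (Finset.mem_filter.1 hpu).2
    by_contra hnot
    have hall : ∀ v : G.right, (u, (v : ℕ)) ∈ G.edges ↔
        b v (π x) (π y) (lab x y) (lab x (z v)) (lab y (z v)) := by
      intro v
      have hv : (x, y) ∉ err v := fun h =>
        hnot (Finset.mem_biUnion.2 ⟨v, Finset.mem_univ _, h⟩)
      simp only [herr, Finset.mem_filter, not_and, not_not] at hv
      rw [← hv hxy]
      exact (Γ.exists_color_iff hu hcol fun u => (u, (v : ℕ)) ∈ G.edges).symm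
    have hex : ∃ u, fits (type x) (type y) (lab x y) u := ⟨u, hu, hall⟩
    simp only [dif_pos hex] at hne
    obtain ⟨hu', hall'⟩ := hex.choose_spec
    refine hne (hG.1 u hu _ hu' fun v => ?_)
    by_cases hv : v ∈ G.right
    · exact (hall ⟨v, hv⟩).trans (hall' ⟨v, hv⟩).symm
    · exact iff_of_false (fun h => hv (Finset.mem_product.1 (G.edges_sub h)).2)
        fun h => hv (Finset.mem_product.1 (G.edges_sub h)).2
  have hn0 : (0 : ℝ) < n := Nat.cast_pos.2 hnpos
  have hk0 : (0 : ℝ) < k := Nat.cast_pos.2 hkpos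
  have hσ : 0 ≤ ε₁ + ℓ ^ 3 * η := by positivity
  have hVle : (H.verts.card : ℝ) ≤ 3 * n := by exact_mod_cast hC.card_verts_le hA hB hn
  have hnk : (n : ℝ) = G.right.card * k := by rw [← hn]; push_cast; rfl
  have herrle : ∀ v, ((err v).card : ℝ) ≤
      27 * (G.right.card : ℝ) * (ε₁ + ℓ ^ 3 * η) * (n : ℝ) ^ 2 := by
    intro v
    have h1 := hb v
    rw [hC.1 v v.2] at h1
    have h2 : (k : ℝ) * ((err v).card : ℝ) ≤ (ε₁ + ℓ ^ 3 * η) * (3 * n) ^ 3 := by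
      refine le_trans ?_ (h1.trans ?_)
      · refine le_of_eq (congrArg (fun s : Finset (ℕ × ℕ) => (k : ℝ) * s.card) ?_)
        simp only [herr]
        congr!
      · gcongr
    refine le_of_mul_le_mul_left (h2.trans_eq ?_) hk0
    calc _ = 27 * (ε₁ + ℓ ^ 3 * η) * (n : ℝ) ^ 2 * n := by ring
      _ = _ := by rw [hnk]; ring
  have hunion : ((Finset.univ.biUnion err).card : ℝ) ≤
      27 * (G.right.card : ℝ) ^ 2 * (ε₁ + ℓ ^ 3 * η) * (n : ℝ) ^ 2 := by
    calc ((Finset.univ.biUnion err).card : ℝ) ≤ ∑ v, ((err v).card : ℝ) := by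
          exact_mod_cast Finset.card_biUnion_le
      _ ≤ ∑ _v : G.right, 27 * (G.right.card : ℝ) * (ε₁ + ℓ ^ 3 * η) * (n : ℝ) ^ 2 :=
          Finset.sum_le_sum fun v _ => herrle v
      _ = _ := by
          rw [Finset.sum_const, Finset.card_univ, Fintype.card_coe, nsmul_eq_mul]; ring
  have hcard : Fintype.card (Fin t × (G.right → Fin ℓ)) = t * ℓ ^ G.right.card := by
    simp
  rw [hcard] at hwrong
  refine le_of_mul_le_mul_right (hwrong.trans (le_trans ?_ hunion)) (by positivity)
  refine Nat.cast_le.2 (le_trans (le_of_eq ?_) (Finset.card_le_card hsub))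
  congr 1

lemma two_pow_mul_pow_le {e u v : ℝ} (he : 0 ≤ e) (hu : 1 ≤ u) (hv : 1 ≤ v)
    (h₁ : e * u ^ 12 ≤ 1) (h₂ : e * v ^ 12 ≤ 1) (h₃ : e * 4 ^ 12 ≤ 1) :
    2 ^ 20 * e ^ 12 ≤ (1 / (256 * u ^ 4 * v ^ 2)) ^ 8 := by
  have hu0 : 0 < u := by linarith
  have hv0 : 0 < v := by linarith
  rw [div_pow, one_pow, le_div_iff₀ (by positivity)]
  have p₁ : (e * u ^ 12) ^ 4 ≤ 1 := pow_le_one₀ (by positivity) h₁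
  have p₂ : (e * v ^ 12) ^ 4 ≤ 1 := pow_le_one₀ (by positivity) h₂
  have p₃ : (e * 4 ^ 12) ^ 4 ≤ 1 := pow_le_one₀ (by positivity) h₃
  have hu' : u ^ 32 ≤ u ^ 48 := pow_le_pow_right₀ hu (by norm_num)
  have hv' : v ^ 16 ≤ v ^ 48 := pow_le_pow_right₀ hv (by norm_num)
  calc 2 ^ 20 * e ^ 12 * (256 * u ^ 4 * v ^ 2) ^ 8
      = 2 ^ 84 * e ^ 12 * u ^ 32 * v ^ 16 := by ring
    _ ≤ 2 ^ 96 * e ^ 12 * u ^ 48 * v ^ 48 := by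
        gcongr 2 ^ ?_ * e ^ 12 * ?_ * ?_
        · exact one_le_two
        · norm_num
    _ = (e * u ^ 12) ^ 4 * (e * v ^ 12) ^ 4 * (e * 4 ^ 12) ^ 4 := by ring
    _ ≤ 1 * 1 * 1 := by gcongr
    _ = 1 := by norm_num

/-- Proposition 5.10: lower bound from blowups of an irreducible bigraph. -/
theorem stmt_16 :
    ∃ K₁ eStar : ℝ, 0 < K₁ ∧ 0 < eStar ∧
      ∀ G : Bigraph, G.Irreducible →
        ∀ ε₁ : ℝ, 0 < ε₁ →
          ε₁ < (G.left.card : ℝ) ^ (-K₁) → ε₁ < (G.right.card : ℝ) ^ (-K₁) →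
          ε₁ < eStar ^ K₁ →
          ∃ ε₂Star : ℕ → ℝ, (∀ x, 0 < ε₂Star x ∧ ε₂Star x < 1) ∧
            ∀ t : ℕ, 1 ≤ t →
              ∀ ε₂ : ℕ → ℝ, (∀ x, 0 < ε₂ x ∧ ε₂ x < 1) → (∀ x, ε₂ x < ε₂Star x) →
                ∃ ε : ℝ, 0 < ε ∧ ∃ n₀ : ℕ, ∀ n : ℕ, n₀ ≤ n → G.right.card ∣ n →
                  ∀ Γ : BipColored G.left, Γ.A.card = n → Γ.B.card = n →
                    (∀ u ∈ G.left, (Γ.colorBG u).EpsRegular ε ∧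
                      |(Γ.colorBG u).density - (G.left.card : ℝ)⁻¹| ≤ ε) →
                    ∀ H : ThreeGraph, IsBlowup G (n / G.right.card) Γ H →
                      ∀ ℓ : ℕ, 1 ≤ ℓ →
                        ∀ P : Decomp H.verts (Fin t) (Fin ℓ),
                          P.isReg (ε₁ ^ K₁) ((ε₂ ℓ) ^ K₁) →
                          P.regWrt H.obar (ε₁ ^ K₁) ((ε₂ ℓ) ^ K₁) →
                          G.left.card ≤ ℓ := by
  refine ⟨12, 1 / 4, by norm_num, by norm_num, fun G hG e he heU heV heS => ?_⟩
  refine ⟨fun _ => 1 / 2, fun _ => by norm_num, fun t ht ε₂ hε₂ _ => ?_⟩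
  set m : ℝ := t * (G.left.card : ℝ) ^ G.right.card + 1 with hm
  have hmpos : 0 < m := by positivity
  set u : ℝ := (G.left.card : ℝ)
  set v : ℝ := (G.right.card : ℝ)
  refine ⟨1 / (8 * (u + 1) * m), by positivity, 1,
    fun n hn hdvd Γ hA hB hΓ H hH ℓ hℓ P _ hreg => ?_⟩
  by_contra! hlt
  have rpow12 : ∀ x : ℝ, 0 ≤ x → x ^ (12 : ℝ) = x ^ 12 := fun x _ => by
    exact_mod_cast Real.rpow_natCast x 12
  have one_le : ∀ w : ℕ, e < (w : ℝ) ^ (-(12 : ℝ)) → (1 : ℝ) ≤ w ∧ e * (w : ℝ) ^ 12 ≤ 1 := by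
    intro w hw
    rw [Real.rpow_neg (Nat.cast_nonneg w), rpow12 _ (Nat.cast_nonneg w)] at hw
    have hw0 : w ≠ 0 := by
      rintro rfl
      norm_num at hw
      linarith
    refine ⟨by exact_mod_cast Nat.one_le_iff_ne_zero.2 hw0, ?_⟩
    have : (0 : ℝ) < (w : ℝ) ^ 12 := by positivity
    rw [lt_inv_comm₀ he this] at hw
    calc e * (w : ℝ) ^ 12 ≤ e * e⁻¹ := by gcongr
      _ = 1 := mul_inv_cancel₀ he.ne'
  obtain ⟨hu1, hU⟩ : 1 ≤ u ∧ e * u ^ 12 ≤ 1 := one_le _ heU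
  obtain ⟨hv1, hV⟩ : 1 ≤ v ∧ e * v ^ 12 ≤ 1 := one_le _ heV
  have hu0 : 0 < u := by linarith
  have hv0 : 0 < v := by linarith
  rw [rpow12 _ (by norm_num)] at heS
  rw [rpow12 _ he.le, rpow12 _ (hε₂ ℓ).1.le] at hreg
  have hη := two_pow_mul_pow_le he.le hu1 hv1 hU hV (by
    have := heS.le
    norm_num at this ⊢
    linarith)
  set η : ℝ := 1 / (256 * u ^ 4 * v ^ 2) with hηdef
  have hη0 : 0 < η := by positivity
  have hη1 : η ≤ 1 := by
    rw [hηdef, div_le_one (by positivity)]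
    have := one_le_pow₀ hu1 (n := 4)
    have := one_le_pow₀ hv1 (n := 2)
    nlinarith
  have heη : e ^ 12 ≤ η := by
    have h1 : η ^ 8 ≤ η := pow_le_of_le_one hη0.le hη1 (by norm_num)
    have h2 : 0 ≤ e ^ 12 := by positivity
    linarith
  have key := hG.inv_card_left_le (Nat.mul_div_cancel' hdvd) hn hA hB (by positivity) hΓ hH ht hℓ
    hlt P (by positivity) (pow_le_one₀ (hε₂ ℓ).1.le (hε₂ ℓ).2.le) hη0.le hη hreg
  have hℓu : (ℓ : ℝ) ≤ u := Nat.cast_le.2 hlt.le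
  have hcard : ((t * ℓ ^ G.right.card : ℕ) : ℝ) ≤ m - 1 := by
    rw [hm]; push_cast; rw [add_sub_cancel_right]; gcongr
  have hlow : 3 / 4 * u⁻¹ ≤
      u⁻¹ - 2 * (1 / (8 * (u + 1) * m)) -
        2 * (t * ℓ ^ G.right.card : ℕ) * (1 / (8 * (u + 1) * m)) := by
    have h1 : (2 + 2 * ((t * ℓ ^ G.right.card : ℕ) : ℝ)) * (1 / (8 * (u + 1) * m)) ≤
        2 * m * (1 / (8 * (u + 1) * m)) := by
      gcongr; linarith
    have h2 : 2 * m * (1 / (8 * (u + 1) * m)) = 1 / 4 * (u + 1)⁻¹ := by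
      field_simp; norm_num
    have h3 : (u + 1)⁻¹ ≤ u⁻¹ := by gcongr; linarith
    linarith
  have hup : 27 * v ^ 2 * (e ^ 12 + ℓ ^ 3 * η) ≤ 27 / 128 * u⁻¹ := by
    calc 27 * v ^ 2 * (e ^ 12 + ℓ ^ 3 * η) ≤ 27 * v ^ 2 * (u ^ 3 * η + u ^ 3 * η) := by
          have : 1 * η ≤ u ^ 3 * η := by gcongr; exact one_le_pow₀ hu1
          gcongr; linarith
      _ = 27 / 128 * u⁻¹ := by
          rw [hηdef]; field_simp; norm_num
  have : 0 < u⁻¹ := by positivity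
  linarith
end
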